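/- (Honda) For every prime number p and every integer a with |a| ≤ 2√p, there exists an elliptic curve E defined over the finite field 𝔽_p whose trace of Frobenius equals a, i.e. #E(𝔽_p) = p + 1 - a. -/

import Mathlib

open Polynomial in
theorem card_exceptional_lower_bound {p : ℕ} [Fact p.Prime] (hp2 : p ≠ 2) (f : (ZMod p)[X])
    (hf : f.Monic) (hdeg : f.natDegree = 3) (ε : ZMod p) (T : Finset (ZMod p))
    (hT : ∀ x, f.eval x = 0 ∨ f.eval x ^ (p / 2) = ε ∨ x ∈ T) :
    p ≤ 4 * T.card + 15 := by
  by_contra! hlt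
  have hp : p.Prime := Fact.out
  have hodd : p % 2 = 1 := hp.eq_two_or_odd.resolve_left hp2
  have hdiv : 2 * (p / 2) + 1 = p := by omega
  set m := p / 2 with hm
  have hm0 : m ≠ 0 := by have := hp.two_le; omega
  have h2m : (2 : (ZMod p)[X]) * (m : (ZMod p)[X]) = -1 := by
    have : ((2 * m + 1 : ℕ) : (ZMod p)[X]) = 0 := by rw [hdiv]; exact CharP.cast_eq_zero _ p
    push_cast at this
    linear_combination this
  set g₁ : (ZMod p)[X] := ∏ x ∈ T, (X - C x) with hg₁
  have hg₁m : g₁.Monic := monic_prod_of_monic _ _ fun x _ => monic_X_sub_C x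
  have hg₁d : g₁.natDegree = T.card := by
    rw [hg₁, natDegree_prod_of_monic]
    · simp
    · exact fun x _ => monic_X_sub_C x
  set Z : (ZMod p)[X] := X ^ p - X with hZ
  have hZdeg : Z.natDegree = p := FiniteField.X_pow_card_sub_X_natDegree_eq _ hp.one_lt
  have hZprod : Z = ∏ x : ZMod p, (X - C x) := by
    have hr : Z.roots = Finset.univ.val := by
      have := FiniteField.roots_X_pow_card_sub_X (ZMod p)
      rwa [ZMod.card] at this
    have h1 : Z.Monic := monic_X_pow_sub (by rw [degree_X]; exact_mod_cast hp.one_lt)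
    have := prod_multiset_X_sub_C_of_monic_of_roots_card_eq h1 (by
      rw [hr, hZdeg]; simp [ZMod.card])
    rw [← this, hr]; rfl
  have hZm : Z.Monic := by
    rw [hZprod]; exact monic_prod_of_monic _ _ fun x _ => monic_X_sub_C x
  have hZdvd : ∀ h : (ZMod p)[X], (∀ x, h.eval x = 0) → Z ∣ h := by
    intro h hh
    rw [hZprod]
    refine Finset.prod_dvd_of_coprime (fun x _ y _ hxy => ?_) fun x _ => dvd_iff_isRoot.2 (hh x)
    exact isCoprime_X_sub_C_of_isUnit_sub (sub_ne_zero.2 hxy).isUnit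
  have hfe := hf.pow m
  have hfd : (f ^ m).natDegree = 3 * m := by rw [hf.natDegree_pow, hdeg, mul_comm]
  set g := f * g₁ with hg
  have hgm : g.Monic := hf.mul hg₁m
  have hgd : g.natDegree = 3 + T.card := by rw [hg, hf.natDegree_mul hg₁m, hdeg, hg₁d]
  obtain ⟨s, hs⟩ : Z ∣ g * (f ^ m - C ε) := by
    apply hZdvd
    intro x
    rcases hT x with h | h | h
    · simp [hg, h]
    · simp [h]
    · have : g₁.eval x = 0 := by
        rw [hg₁, eval_prod]; exact Finset.prod_eq_zero h (by simp)
      simp [hg, this]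
  have hfm : (f ^ m - C ε).natDegree = 3 * m := by
    rw [natDegree_sub_C, hfd]
  have hfne : f ^ m - C ε ≠ 0 := fun h => by rw [h] at hfm; simp at hfm; omega
  have hsne : s ≠ 0 := by
    rintro rfl
    rw [mul_zero] at hs
    rcases mul_eq_zero.1 hs with h | h
    · exact hgm.ne_zero h
    · exact hfne h
  have hsd : s.natDegree + p = 3 + T.card + 3 * m := by
    have := congrArg natDegree hs
    rw [natDegree_mul hgm.ne_zero hfne, natDegree_mul hZm.ne_zero hsne, hgd, hfm, hZdeg] at this
    omega
  have hZ' : derivative Z = -1 := by simp [hZ, derivative_X_pow]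
  have hder := congrArg derivative hs
  have hpow : derivative (f ^ m) * f = m * f ^ m * derivative f := by
    rw [derivative_pow]
    obtain ⟨k, hk⟩ := Nat.exists_eq_succ_of_ne_zero hm0
    rw [hk]
    simp only [Nat.succ_eq_add_one, Nat.add_sub_cancel, map_natCast]
    ring
  simp only [derivative_mul, derivative_sub, derivative_C, hZ'] at hder
  have key : Z ∣ g * (C ε * g * derivative f - 2 * f * s) := by
    refine ⟨(2 * f * derivative g - g * derivative f) * s - 2 * f * g * derivative s, ?_⟩
    linear_combination (-2 * f * g) * hder + 2 * g ^ 2 * hpow + g ^ 2 * f ^ m * derivative f * h2m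
      + (2 * f * derivative g - g * derivative f) * hs
  have hfd' : (derivative f).natDegree ≤ 2 := by
    have := natDegree_derivative_le f; omega
  have hzero : g * (C ε * g * derivative f - 2 * f * s) = 0 := by
    refine eq_zero_of_dvd_of_natDegree_lt key ?_
    rw [hZdeg]
    have e1 : (C ε * g * derivative f).natDegree ≤ T.card + 5 := by
      refine natDegree_mul_le.trans ?_
      have := natDegree_C_mul_le ε g
      omega
    have e2 : (2 * f * s).natDegree ≤ 3 + s.natDegree := by
      refine natDegree_mul_le.trans ?_
      have : (2 * f).natDegree ≤ 3 := by
        have := natDegree_C_mul_le (2 : ZMod p) f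
        rw [hdeg] at this
        simpa only [C_ofNat] using this
      omega
    have e3 := natDegree_sub_le (C ε * g * derivative f) (2 * f * s)
    have e4 : (g * (C ε * g * derivative f - 2 * f * s)).natDegree ≤
      3 + T.card + max (T.card + 5) (3 + s.natDegree) := by
      refine natDegree_mul_le.trans ?_
      rw [hgd]
      have : max (C ε * g * derivative f).natDegree (2 * f * s).natDegree ≤
          max (T.card + 5) (3 + s.natDegree) := max_le_max e1 e2
      omega
    omega
  have h3 : C ε * g₁ * derivative f = 2 * s := by
    have := (mul_eq_zero.1 hzero).resolve_left hgm.ne_zero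
    have h4 : f * (C ε * g₁ * derivative f - 2 * s) = 0 := by rw [← this, hg]; ring
    exact sub_eq_zero.1 ((mul_eq_zero.1 h4).resolve_left hf.ne_zero)
  have h2ne : (2 : ZMod p) ≠ 0 := by
    intro h
    have : ((2 : ℕ) : ZMod p) = 0 := by exact_mod_cast h
    rw [ZMod.natCast_eq_zero_iff] at this
    exact hp2 ((Nat.prime_dvd_prime_iff_eq hp Nat.prime_two).1 this)
  have h5 : (2 * s).natDegree = s.natDegree := by
    have := natDegree_C_mul (p := s) h2ne
    simpa only [C_ofNat] using this
  have h6 : (C ε * g₁ * derivative f).natDegree ≤ T.card + 2 := by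
    refine natDegree_mul_le.trans ?_
    have := natDegree_C_mul_le ε g₁
    omega
  rw [h3, h5] at h6
  omega

open Polynomial in
/-- The cubic polynomial `X³ + αX + β`. -/
noncomputable def shortCubic {S : Type*} [CommRing S] (α β : S) : S[X] := X ^ 3 + C α * X + C β

open Polynomial in
theorem shortCubic_natDegree {S : Type*} [CommRing S] [Nontrivial S] (α β : S) :
    (shortCubic α β).natDegree = 3 := by
  unfold shortCubic; compute_degree!

open Polynomial in
theorem shortCubic_monic {S : Type*} [CommRing S] [Nontrivial S] (α β : S) :
    (shortCubic α β).Monic := by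
  unfold shortCubic; monicity!

open Polynomial in
theorem shortCubic_map {S S' : Type*} [CommRing S] [CommRing S'] (φ : S →+* S') (α β : S) :
    (shortCubic α β).map φ = shortCubic (φ α) (φ β) := by
  simp [shortCubic]

/-- The Hasse invariant of `y² = x³ + αx + β`: the coefficient of `x^(p-1)` in
`(x³ + αx + β)^((p-1)/2)`. -/
noncomputable def hasseInvariant {S : Type*} [CommRing S] (p : ℕ) (α β : S) : S :=
  ((shortCubic α β) ^ (p / 2)).coeff (p - 1)

theorem hasseInvariant_map {S S' : Type*} [CommRing S] [CommRing S'] (φ : S →+* S') (p : ℕ)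
    (α β : S) : φ (hasseInvariant p α β) = hasseInvariant p (φ α) (φ β) := by
  rw [hasseInvariant, hasseInvariant, ← shortCubic_map, ← Polynomial.map_pow,
    Polynomial.coeff_map]

theorem sum_eval_eq_neg_coeff {p : ℕ} [Fact p.Prime] (P : Polynomial (ZMod p))
    (hP : P.natDegree < 2 * (p - 1)) : ∑ x : ZMod p, P.eval x = -P.coeff (p - 1) := by
  have hp : p.Prime := Fact.out
  have h2 := hp.two_le
  have key : ∀ i < 2 * (p - 1), ∑ x : ZMod p, x ^ i = if i = p - 1 then -1 else 0 := by
    intro i hi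
    rcases lt_trichotomy i (p - 1) with h | h | h
    · rw [if_neg h.ne]
      exact FiniteField.sum_pow_lt_card_sub_one _ i (by rwa [ZMod.card])
    · rw [if_pos h, h]
      rw [← Finset.add_sum_erase _ _ (Finset.mem_univ (0 : ZMod p)), zero_pow (by omega), zero_add]
      rw [Finset.sum_congr rfl (g := fun _ => (1 : ZMod p))]
      · simp [Finset.card_erase_of_mem, ZMod.card, Nat.cast_sub hp.one_le]
      · intro x hx
        exact ZMod.pow_card_sub_one_eq_one (Finset.ne_of_mem_erase hx)
    · rw [if_neg h.ne']
      obtain ⟨j, rfl⟩ : ∃ j, i = p + j := ⟨i - p, by omega⟩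
      have : ∀ x : ZMod p, x ^ (p + j) = x ^ (j + 1) := fun x => by
        rw [pow_add, ZMod.pow_card, pow_succ, mul_comm]
      rw [Finset.sum_congr rfl fun x _ => this x]
      exact FiniteField.sum_pow_lt_card_sub_one _ _ (by rw [ZMod.card]; omega)
  simp_rw [Polynomial.eval_eq_sum_range' hP]
  rw [Finset.sum_comm]
  simp_rw [← Finset.mul_sum]
  rw [Finset.sum_congr rfl fun i hi => by rw [key i (Finset.mem_range.1 hi)]]
  have : p - 1 < 2 * (p - 1) := by omega
  simp [this]

theorem sum_quadraticChar_shortCubic {p : ℕ} [Fact p.Prime] (hp2 : p ≠ 2) (α β : ZMod p) :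
    ((∑ x : ZMod p, quadraticChar (ZMod p) ((shortCubic α β).eval x) : ℤ) : ZMod p) =
      -hasseInvariant p α β := by
  have hp : p.Prime := Fact.out
  have hodd : p % 2 = 1 := hp.eq_two_or_odd.resolve_left hp2
  have h2 := hp.two_le
  rw [hasseInvariant, ← sum_eval_eq_neg_coeff]
  · push_cast
    refine Finset.sum_congr rfl fun x _ => ?_
    rw [quadraticChar_eq_pow_of_char_ne_two' (by rwa [ZMod.ringChar_zmod_n]), ZMod.card,
      Polynomial.eval_pow]
  · rw [(shortCubic_monic α β).natDegree_pow, shortCubic_natDegree]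
    omega

/-- The short Weierstrass curve `y² = x³ + αx + β`. -/
def shortCurve {S : Type*} [CommRing S] (α β : S) : WeierstrassCurve S := ⟨0, 0, 0, α, β⟩

theorem shortCurve_Δ {S : Type*} [CommRing S] (α β : S) :
    (shortCurve α β).Δ = -16 * (4 * α ^ 3 + 27 * β ^ 2) := by
  simp only [shortCurve, WeierstrassCurve.Δ, WeierstrassCurve.b₂, WeierstrassCurve.b₄,
    WeierstrassCurve.b₆, WeierstrassCurve.b₈]
  ring

theorem card_point_eq_sum {F : Type*} [Field F] [Fintype F] [DecidableEq F] (W : WeierstrassCurve F)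
    [W.IsElliptic] :
    Nat.card W.toAffine.Point = 1 + ∑ x : F, Nat.card {y : F // W.toAffine.Equation x y} := by
  have e : W.toAffine.Point ≃ Option (Σ x : F, {y : F // W.toAffine.Equation x y}) :=
    { toFun := fun P => match P with
        | .zero => none
        | .some x y h => some ⟨x, y, h.1⟩
      invFun := fun o => match o with
        | none => .zero
        | some ⟨x, y, h⟩ => .some x y (WeierstrassCurve.Affine.equation_iff_nonsingular.1 h)
      left_inv := fun P => by cases P <;> rfl
      right_inv := fun o => by rcases o with _ | ⟨x, y, h⟩ <;> rfl }
  rw [Nat.card_congr e, Finite.card_option, Nat.card_sigma, add_comm]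

theorem card_point_shortCurve {p : ℕ} [Fact p.Prime] (hp2 : p ≠ 2) (α β : ZMod p)
    [(shortCurve α β).IsElliptic] :
    (Nat.card (shortCurve α β).toAffine.Point : ℤ) =
      p + 1 + ∑ x : ZMod p, quadraticChar (ZMod p) ((shortCubic α β).eval x) := by
  rw [card_point_eq_sum]
  have : ∀ x : ZMod p, (Nat.card {y : ZMod p // (shortCurve α β).toAffine.Equation x y} : ℤ) =
      quadraticChar (ZMod p) ((shortCubic α β).eval x) + 1 := by
    intro x
    rw [← quadraticChar_card_sqrts (by rwa [ZMod.ringChar_zmod_n])]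
    rw [← Set.ncard_eq_toFinset_card', ← Nat.card_coe_set_eq]
    congr 1
    refine Nat.card_congr (Equiv.subtypeEquivRight fun y => ?_)
    rw [WeierstrassCurve.Affine.equation_iff]
    simp [shortCurve, shortCubic]
  push_cast
  simp_rw [this, Finset.sum_add_distrib]
  simp [ZMod.card]
  ring

theorem exists_curve_of_hasseInvariant {p : ℕ} [Fact p.Prime] (hp : 41 ≤ p) (a : ℤ)
    (ha : a ^ 2 ≤ 4 * p) (α β : ZMod p) (hΔ : 4 * α ^ 3 + 27 * β ^ 2 ≠ 0)
    (h : hasseInvariant p α β = a) :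
    ∃ W : WeierstrassCurve (ZMod p), W.IsElliptic ∧
      (Nat.card W.toAffine.Point : ℤ) = p + 1 - a := by
  have hp2 : p ≠ 2 := by omega
  have hpr : p.Prime := Fact.out
  have h2 : (2 : ZMod p) ≠ 0 := by
    intro h
    have : ((2 : ℕ) : ZMod p) = 0 := by exact_mod_cast h
    rw [ZMod.natCast_eq_zero_iff] at this
    exact hp2 ((Nat.prime_dvd_prime_iff_eq hpr Nat.prime_two).1 this)
  have hell : (shortCurve α β).IsElliptic := by
    rw [WeierstrassCurve.isElliptic_iff, shortCurve_Δ, isUnit_iff_ne_zero]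
    refine mul_ne_zero ?_ hΔ
    have : (-16 : ZMod p) = -(2 ^ 4) := by norm_num
    rw [this]
    exact neg_ne_zero.2 (pow_ne_zero _ h2)
  refine ⟨shortCurve α β, hell, ?_⟩
  rw [card_point_shortCurve hp2]
  set χ : ZMod p → ℤ := fun x => quadraticChar (ZMod p) ((shortCubic α β).eval x) with hχ
  have hS := sum_quadraticChar_shortCubic hp2 α β
  change ((∑ x, χ x : ℤ) : ZMod p) = _ at hS
  change (p : ℤ) + 1 + ∑ x, χ x = _
  have bound : ∀ ε : ℤ, ε = 1 ∨ ε = -1 → ∃ n : ℕ, p ≤ 4 * n + 15 ∧ ε * ∑ x, χ x + 2 * n ≤ p := by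
    intro ε hε
    set T : Finset (ZMod p) := Finset.univ.filter fun x => χ x = -ε with hT
    refine ⟨T.card, card_exceptional_lower_bound hp2 (shortCubic α β) (shortCubic_monic α β)
      (shortCubic_natDegree α β) (ε : ZMod p) T fun x => ?_, ?_⟩
    · have hx : ((χ x : ℤ) : ZMod p) = (shortCubic α β).eval x ^ (p / 2) := by
        rw [hχ]; simp only
        rw [quadraticChar_eq_pow_of_char_ne_two' (by rwa [ZMod.ringChar_zmod_n]), ZMod.card]
      rw [← hx]
      by_cases h0 : (shortCubic α β).eval x = 0
      · exact Or.inl h0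
      right
      rcases quadraticChar_dichotomy h0 with h1 | h1 <;> change χ x = _ at h1 <;>
        rcases hε with rfl | rfl <;> simp [hT, h1]
    · have : ∀ x, ε * χ x + 2 * (if x ∈ T then 1 else 0) ≤ 1 := by
        intro x
        by_cases hx : x ∈ T
        · have : χ x = -ε := by simpa [hT] using hx
          rw [if_pos hx, this]
          rcases hε with rfl | rfl <;> norm_num
        · rw [if_neg hx]
          have : χ x = 0 ∨ χ x = 1 ∨ χ x = -1 := by
            by_cases h0 : (shortCubic α β).eval x = 0
            · left; simp [hχ, h0]
            · exact Or.inr (quadraticChar_dichotomy h0)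
          rcases hε with rfl | rfl <;> rcases this with h | h | h <;> rw [h] <;> norm_num
      have h1 := Finset.sum_le_sum fun x (_ : x ∈ Finset.univ) => this x
      rw [Finset.sum_add_distrib, ← Finset.mul_sum, ← Finset.mul_sum, Finset.sum_ite_mem] at h1
      simpa [ZMod.card] using h1
  obtain ⟨n₁, hn₁, hn₁'⟩ := bound 1 (Or.inl rfl)
  obtain ⟨n₂, hn₂, hn₂'⟩ := bound (-1) (Or.inr rfl)
  have hdvd : (p : ℤ) ∣ ∑ x, χ x + a := by
    rw [← ZMod.intCast_zmod_eq_zero_iff_dvd]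
    push_cast
    push_cast at hS
    rw [hS, h]; ring
  obtain ⟨c, hc⟩ := hdvd
  have hpZ : (41 : ℤ) ≤ p := by exact_mod_cast hp
  have ha1 : 2 * a < p - 15 := by
    by_contra! hcon
    nlinarith
  have ha2 : -(2 * a) < p - 15 := by
    by_contra! hcon
    nlinarith
  have hn₁Z : (p : ℤ) ≤ 4 * n₁ + 15 := by exact_mod_cast hn₁
  have hn₂Z : (p : ℤ) ≤ 4 * n₂ + 15 := by exact_mod_cast hn₂
  have hc0 : c = 0 := by
    have h1 : c < 1 := by nlinarith
    have h2 : -1 < c := by nlinarith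
    omega
  rw [hc0] at hc
  linarith

theorem card_point_eq_card_filter {p : ℕ} [Fact p.Prime] (W : WeierstrassCurve (ZMod p))
    [W.IsElliptic] :
    Nat.card W.toAffine.Point = 1 + ∑ x : ZMod p, (Finset.univ.filter fun y : ZMod p =>
      y ^ 2 + W.a₁ * x * y + W.a₃ * y = x ^ 3 + W.a₂ * x ^ 2 + W.a₄ * x + W.a₆).card := by
  rw [card_point_eq_sum]
  congr 1
  refine Finset.sum_congr rfl fun x _ => ?_
  refine Nat.subtype_card _ fun y => ?_
  rw [Finset.mem_filter_univ, WeierstrassCurve.Affine.equation_iff]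

/-- The sum of the Legendre symbols of `x³ + αx + β` modulo `p`, computed by Euler's criterion. -/
def legendreSum (p α β : ℕ) : ℤ :=
  (List.range p).foldr (fun x s =>
    (if (x ^ 3 + α * x + β) ^ (p / 2) % p = 1 then 1
      else if (x ^ 3 + α * x + β) ^ (p / 2) % p = 0 then 0 else -1) + s) 0

theorem quadraticChar_natCast {p : ℕ} [Fact p.Prime] (hp2 : p ≠ 2) (n : ℕ) :
    quadraticChar (ZMod p) (n : ZMod p) =
      if n ^ (p / 2) % p = 1 then 1 else if n ^ (p / 2) % p = 0 then 0 else -1 := by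
  have hp : p.Prime := Fact.out
  have h3 : 1 % p = 1 := Nat.mod_eq_of_lt hp.one_lt
  have hq := quadraticChar_eq_pow_of_char_ne_two (F := ZMod p) (by rwa [ZMod.ringChar_zmod_n])
    (a := (n : ZMod p))
  have e1 : (n : ZMod p) ^ (p / 2) = 1 ↔ n ^ (p / 2) % p = 1 := by
    rw [← Nat.cast_pow, ← Nat.cast_one, ZMod.natCast_eq_natCast_iff', h3]
  have e0 : (n : ZMod p) = 0 ↔ n ^ (p / 2) % p = 0 := by
    have : p / 2 ≠ 0 := by have := hp.two_le; omega
    rw [← Nat.dvd_iff_mod_eq_zero, ← ZMod.natCast_eq_zero_iff]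
    push_cast
    rw [pow_eq_zero_iff this]
  by_cases h0 : (n : ZMod p) = 0
  · rw [h0, quadraticChar_zero]
    have := e0.1 h0
    simp [this]
  · rw [hq h0, ZMod.card]
    simp only [e1]
    split_ifs with h h' <;> first | rfl | exact absurd (e0.2 h') h0

theorem sum_quadraticChar_eq_legendreSum {p : ℕ} [Fact p.Prime] (hp2 : p ≠ 2) (α β : ℕ) :
    ∑ x : ZMod p, quadraticChar (ZMod p) ((shortCubic (α : ZMod p) (β : ZMod p)).eval x) =
      legendreSum p α β := by
  have hp : p.Prime := Fact.out
  have h1 : ∑ x : ZMod p, quadraticChar (ZMod p) ((shortCubic (α : ZMod p) (β : ZMod p)).eval x) =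
      ∑ x ∈ Finset.range p, quadraticChar (ZMod p) ((x ^ 3 + α * x + β : ℕ) : ZMod p) := by
    refine (Finset.sum_nbij (fun x : ℕ => (x : ZMod p)) (by simp) ?_ ?_ ?_).symm
    · intro x hx y hy hxy
      simp only [Finset.coe_range, Set.mem_Iio] at hx hy
      have := (ZMod.natCast_eq_natCast_iff' x y p).1 hxy
      rwa [Nat.mod_eq_of_lt hx, Nat.mod_eq_of_lt hy] at this
    · intro x _
      exact ⟨x.val, by simpa using ZMod.val_lt x, by simp⟩
    · intro x _
      simp [shortCubic]
  rw [h1, legendreSum]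
  simp_rw [quadraticChar_natCast hp2]
  rw [Finset.sum_range, ← List.sum_ofFn, List.ofFn_eq_map, List.sum, List.foldr_map]
  rw [← List.map_coe_finRange_eq_range, List.foldr_map]

theorem exists_curve_of_legendreSum {p : ℕ} [Fact p.Prime] (hp2 : p ≠ 2) (a : ℤ)
    (h : ∃ α < p, ∃ β < p, (4 * α ^ 3 + 27 * β ^ 2) % p ≠ 0 ∧ legendreSum p α β = -a) :
    ∃ W : WeierstrassCurve (ZMod p), W.IsElliptic ∧
      (Nat.card W.toAffine.Point : ℤ) = p + 1 - a := by
  obtain ⟨α, -, β, -, hΔ, h⟩ := h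
  have hpr : p.Prime := Fact.out
  have h2 : (2 : ZMod p) ≠ 0 := by
    intro h
    have : ((2 : ℕ) : ZMod p) = 0 := by exact_mod_cast h
    rw [ZMod.natCast_eq_zero_iff] at this
    exact hp2 ((Nat.prime_dvd_prime_iff_eq hpr Nat.prime_two).1 this)
  have hell : (shortCurve (α : ZMod p) (β : ZMod p)).IsElliptic := by
    rw [WeierstrassCurve.isElliptic_iff, shortCurve_Δ, isUnit_iff_ne_zero]
    refine mul_ne_zero ?_ fun h0 => hΔ ?_
    · have : (-16 : ZMod p) = -(2 ^ 4) := by norm_num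
      rw [this]
      exact neg_ne_zero.2 (pow_ne_zero _ h2)
    · rw [← Nat.dvd_iff_mod_eq_zero, ← ZMod.natCast_eq_zero_iff]
      exact_mod_cast h0
  refine ⟨shortCurve (α : ZMod p) (β : ZMod p), hell, ?_⟩
  rw [card_point_shortCurve hp2, sum_quadraticChar_eq_legendreSum hp2, h]
  ring

theorem exists_curve_of_coefficients {p : ℕ} [Fact p.Prime] (a : ℤ) (a₁ a₂ a₃ a₄ a₆ : ZMod p)
    (hΔ : (⟨a₁, a₂, a₃, a₄, a₆⟩ : WeierstrassCurve (ZMod p)).Δ ≠ 0)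
    (h : ((1 + ∑ x : ZMod p, (Finset.univ.filter fun y : ZMod p =>
      y ^ 2 + a₁ * x * y + a₃ * y = x ^ 3 + a₂ * x ^ 2 + a₄ * x + a₆).card : ℕ) : ℤ) =
        p + 1 - a) :
    ∃ W : WeierstrassCurve (ZMod p), W.IsElliptic ∧
      (Nat.card W.toAffine.Point : ℤ) = p + 1 - a := by
  have hell : (⟨a₁, a₂, a₃, a₄, a₆⟩ : WeierstrassCurve (ZMod p)).IsElliptic := by
    rw [WeierstrassCurve.isElliptic_iff, isUnit_iff_ne_zero]
    exact hΔ
  refine ⟨_, hell, ?_⟩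
  rw [card_point_eq_card_filter]
  exact h

theorem exists_curve_two (a : ℤ) (ha : a ^ 2 ≤ 4 * 2) :
    ∃ W : WeierstrassCurve (ZMod 2), W.IsElliptic ∧
      (Nat.card W.toAffine.Point : ℤ) = (2 : ℕ) + 1 - a := by
  have h1 : -2 ≤ a := by nlinarith
  have h2 : a ≤ 2 := by nlinarith
  interval_cases a
  · exact exists_curve_of_coefficients _ 0 0 1 1 0 (by decide) (by decide)
  · exact exists_curve_of_coefficients _ 1 0 0 0 1 (by decide) (by decide)
  · exact exists_curve_of_coefficients _ 0 0 1 0 0 (by decide) (by decide)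
  · exact exists_curve_of_coefficients _ 1 0 1 0 1 (by decide) (by decide)
  · exact exists_curve_of_coefficients _ 0 0 1 1 1 (by decide) (by decide)

theorem exists_curve_three (a : ℤ) (ha : a ^ 2 ≤ 4 * 3) :
    ∃ W : WeierstrassCurve (ZMod 3), W.IsElliptic ∧
      (Nat.card W.toAffine.Point : ℤ) = (3 : ℕ) + 1 - a := by
  have h1 : -3 ≤ a := by nlinarith
  have h2 : a ≤ 3 := by nlinarith
  interval_cases a
  · exact exists_curve_of_coefficients _ 0 0 0 2 1 (by decide) (by decide)
  · exact exists_curve_of_coefficients _ 0 1 0 0 1 (by decide) (by decide)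
  · exact exists_curve_of_coefficients _ 0 2 0 0 1 (by decide) (by decide)
  · exact exists_curve_of_coefficients _ 0 0 0 1 0 (by decide) (by decide)
  · exact exists_curve_of_coefficients _ 0 1 0 0 2 (by decide) (by decide)
  · exact exists_curve_of_coefficients _ 0 2 0 0 2 (by decide) (by decide)
  · exact exists_curve_of_coefficients _ 0 0 0 2 2 (by decide) (by decide)

/-- Every trace in the interval `[-s, s]` is attained by a short Weierstrass curve modulo `p`. -/
def AllTracesAttained (p s : ℕ) : Prop :=
  ∀ i < 2 * s + 1, ∃ α < p, ∃ β < p, (4 * α ^ 3 + 27 * β ^ 2) % p ≠ 0 ∧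
    legendreSum p α β = s - i

instance (p s : ℕ) : Decidable (AllTracesAttained p s) := by
  unfold AllTracesAttained
  infer_instance

theorem exists_curve_of_allTracesAttained {p s : ℕ} (hp : p.Prime) (hp2 : p ≠ 2) (a : ℤ)
    (ha : a ^ 2 ≤ 4 * p) (hs : 4 * p < (s + 1) ^ 2) (h : AllTracesAttained p s) :
    ∃ W : WeierstrassCurve (ZMod p), W.IsElliptic ∧
      (Nat.card W.toAffine.Point : ℤ) = p + 1 - a := by
  have : Fact p.Prime := ⟨hp⟩
  have hs' : (4 * p : ℤ) < ((s : ℤ) + 1) ^ 2 := by exact_mod_cast hs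
  have hlt : a ^ 2 < ((s : ℤ) + 1) ^ 2 := ha.trans_lt hs'
  have habs := abs_lt_of_sq_lt_sq hlt (by positivity)
  rw [abs_lt] at habs
  obtain ⟨α, hα, β, hβ, hΔ, hsum⟩ := h (a + s).toNat (by omega)
  refine exists_curve_of_legendreSum hp2 a ⟨α, hα, β, hβ, hΔ, ?_⟩
  rw [hsum]
  omega

theorem exists_curve_of_lt {p : ℕ} (hp : p.Prime) (hlt : p < 41) (a : ℤ) (ha : a ^ 2 ≤ 4 * p) :
    ∃ W : WeierstrassCurve (ZMod p), W.IsElliptic ∧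
      (Nat.card W.toAffine.Point : ℤ) = p + 1 - a := by
  have key : ∀ s : ℕ, p ≠ 2 → 4 * p < (s + 1) ^ 2 → AllTracesAttained p s → 
      ∃ W : WeierstrassCurve (ZMod p), W.IsElliptic ∧
      (Nat.card W.toAffine.Point : ℤ) = p + 1 - a := fun s h2 hs h =>
    exists_curve_of_allTracesAttained hp h2 a ha hs h
  by_cases hmem : p ∈ [2, 3, 5, 7, 11, 13, 17, 19, 23, 29, 31, 37]
  · simp only [List.mem_cons, List.not_mem_nil, or_false] at hmem
    rcases hmem with rfl | rfl | rfl | rfl | rfl | rfl | rfl | rfl | rfl | rfl | rfl | rfl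
    · exact exists_curve_two a ha
    · exact exists_curve_three a ha
    · exact key 4 (by norm_num) (by norm_num) (by decide +kernel)
    · exact key 5 (by norm_num) (by norm_num) (by decide +kernel)
    · exact key 6 (by norm_num) (by norm_num) (by decide +kernel)
    · exact key 7 (by norm_num) (by norm_num) (by decide +kernel)
    · exact key 8 (by norm_num) (by norm_num) (by decide +kernel)
    · exact key 8 (by norm_num) (by norm_num) (by decide +kernel)
    · exact key 9 (by norm_num) (by norm_num) (by decide +kernel)
    · exact key 10 (by norm_num) (by norm_num) (by decide +kernel)
    · exact key 11 (by norm_num) (by norm_num) (by decide +kernel)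
    · exact key 12 (by norm_num) (by norm_num) (by decide +kernel)
  · clear key ha
    exfalso
    interval_cases p <;> first | exact hmem (by decide) | (revert hp; norm_num)

section

open UpperHalfPlane ModularForm
open scoped MatrixGroups

/-- `G` is a power series in `exp (2πiτ/N)` converging to `F` on the upper half plane. -/
def QRep (N : ℝ) (F : ℍ → ℂ) (G : PowerSeries ℂ) : Prop :=
  ∀ τ : ℍ, HasSum (fun n => PowerSeries.coeff n G * Function.Periodic.qParam N τ ^ n) (F τ)

namespace QRep

variable {N : ℝ} {F F' : ℍ → ℂ} {G G' : PowerSeries ℂ}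

theorem add (h : QRep N F G) (h' : QRep N F' G') : QRep N (F + F') (G + G') := fun τ => by
  simpa [add_mul] using (h τ).add (h' τ)

theorem sub (h : QRep N F G) (h' : QRep N F' G') : QRep N (F - F') (G - G') := fun τ => by
  simpa [sub_mul] using (h τ).sub (h' τ)

theorem smul (c : ℂ) (h : QRep N F G) : QRep N (c • F) (c • G) := fun τ => by
  simpa [mul_assoc] using (h τ).mul_left c

theorem mul (h : QRep N F G) (h' : QRep N F' G') : QRep N (F * F') (G * G') := fun τ => by
  have e : (fun n => PowerSeries.coeff n (G * G') * Function.Periodic.qParam N τ ^ n) = fun n =>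
      ∑ kl ∈ Finset.HasAntidiagonal.antidiagonal n,
        (PowerSeries.coeff kl.1 G * Function.Periodic.qParam N τ ^ kl.1) *
        (PowerSeries.coeff kl.2 G' * Function.Periodic.qParam N τ ^ kl.2) := by
    ext n
    rw [PowerSeries.coeff_mul, Finset.sum_mul]
    refine Finset.sum_congr rfl fun kl hkl => ?_
    rw [← Finset.HasAntidiagonal.mem_antidiagonal.1 hkl, pow_add]
    ring
  rw [e, Pi.mul_apply, ← (h τ).tsum_eq, ← (h' τ).tsum_eq,
    tsum_mul_tsum_eq_tsum_sum_antidiagonal_of_summable_norm (h τ).summable.norm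
      (h' τ).summable.norm]
  exact (summable_norm_sum_mul_antidiagonal_of_summable_norm (h τ).summable.norm
      (h' τ).summable.norm).of_norm.hasSum

theorem const (c : ℂ) : QRep N (fun _ => c) (PowerSeries.C c) := fun τ => by
  convert hasSum_single 0 ?_ using 1
  · simp
  · intro n hn
    simp [PowerSeries.coeff_C, hn]

theorem one : QRep N 1 1 := by
  simpa using! const (N := N) 1

theorem pow (h : QRep N F G) (n : ℕ) : QRep N (F ^ n) (G ^ n) := by
  induction n with
  | zero => simpa using one
  | succ n ih => simpa [pow_succ] using ih.mul h

theorem prod {ι : Type*} (s : Finset ι) {F : ι → ℍ → ℂ} {G : ι → PowerSeries ℂ}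
    (h : ∀ i ∈ s, QRep N (F i) (G i)) : QRep N (∏ i ∈ s, F i) (∏ i ∈ s, G i) := by
  classical
  induction s using Finset.induction_on with
  | empty => simpa using one
  | insert a s ha ih =>
    rw [Finset.prod_insert ha, Finset.prod_insert ha]
    exact (h a (by simp)).mul (ih fun i hi => h i (by simp [hi]))

theorem isBoundedAtImInfty (hN : 0 < N) (h : QRep N F G) : IsBoundedAtImInfty F :=
  isBoundedAtImInfty_of_hasSum_qExpansion hN h

theorem modularForm {k : ℤ} (f : ModularForm 𝒮ℒ k) : QRep 1 f (qExpansion 1 f) := fun τ =>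
  ModularForm.hasSum_qExpansion f one_pos one_mem_strictPeriods_SL τ

theorem unique {k : ℤ} (f : ModularForm 𝒮ℒ k) {N : ℕ} (hN : 0 < N)
    (h : QRep N f G) (h' : QRep N f G') : G = G' := by
  have hp : (N : ℝ) ∈ (𝒮ℒ).strictPeriods := by
    have := nsmul_mem one_mem_strictPeriods_SL N
    simpa using this
  have hN' : (0 : ℝ) < N := by exact_mod_cast hN
  ext n
  rw [ModularFormClass.qExpansion_coeff_unique hN' hp h n,
    ModularFormClass.qExpansion_coeff_unique hN' hp h' n]

theorem expand (M : ℕ) (hM : M ≠ 0) (h : QRep N F G) :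
    QRep (M * N) F (PowerSeries.expand M hM G) := fun τ => by
  have e : Function.Periodic.qParam N τ = Function.Periodic.qParam (M * N) τ ^ M := by
    rw [Function.Periodic.qParam, Function.Periodic.qParam, ← Complex.exp_nat_mul]
    congr 1
    have : (M : ℂ) ≠ 0 := by exact_mod_cast hM
    push_cast
    field_simp
  have hinj : Function.Injective fun n : ℕ => M * n := fun a b h =>
    Nat.eq_of_mul_eq_mul_left (Nat.pos_of_ne_zero hM) h
  have := h τ
  rw [e] at this
  rw [← hinj.hasSum_iff]
  · convert this using 2 with n
    rw [Function.comp_apply, PowerSeries.coeff_expand_mul, pow_mul]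
  · intro x hx
    rw [PowerSeries.coeff_expand_of_not_dvd, zero_mul]
    rintro ⟨c, rfl⟩
    exact hx ⟨c, rfl⟩

end QRep

/-- `F` is a modular form of level one and weight `K` whose `q`-expansion is the image of the
power series `g` over `R`. -/
def IsIntegralForm (R : Type*) [CommRing R] [Algebra R ℂ] (K : ℤ) (F : ℍ → ℂ)
    (g : PowerSeries R) : Prop :=
  (∃ f : ModularForm 𝒮ℒ K, ⇑f = F) ∧ QRep 1 F (PowerSeries.map (algebraMap R ℂ) g)

namespace IsIntegralForm

variable {R : Type*} [CommRing R] [Algebra R ℂ] {K K' : ℤ} {F F' : ℍ → ℂ} {g g' : PowerSeries R}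

theorem add (h : IsIntegralForm R K F g) (h' : IsIntegralForm R K F' g') :
    IsIntegralForm R K (F + F') (g + g') := by
  obtain ⟨⟨f, rfl⟩, h⟩ := h
  obtain ⟨⟨f', rfl⟩, h'⟩ := h'
  exact ⟨⟨f + f', rfl⟩, by simpa using h.add h'⟩

theorem sub (h : IsIntegralForm R K F g) (h' : IsIntegralForm R K F' g') :
    IsIntegralForm R K (F - F') (g - g') := by
  obtain ⟨⟨f, rfl⟩, h⟩ := h
  obtain ⟨⟨f', rfl⟩, h'⟩ := h'
  exact ⟨⟨f - f', rfl⟩, by simpa using h.sub h'⟩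

theorem smul (r : R) (h : IsIntegralForm R K F g) :
    IsIntegralForm R K (algebraMap R ℂ r • F) (PowerSeries.C r * g) := by
  obtain ⟨⟨f, rfl⟩, h⟩ := h
  refine ⟨⟨algebraMap R ℂ r • f, rfl⟩, ?_⟩
  have := h.smul (algebraMap R ℂ r)
  rwa [map_mul, PowerSeries.map_C, ← PowerSeries.smul_eq_C_mul]

theorem mul (h : IsIntegralForm R K F g) (h' : IsIntegralForm R K' F' g') :
    IsIntegralForm R (K + K') (F * F') (g * g') := by
  obtain ⟨⟨f, rfl⟩, h⟩ := h
  obtain ⟨⟨f', rfl⟩, h'⟩ := h'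
  exact ⟨⟨f.mul f', rfl⟩, by simpa using h.mul h'⟩

theorem one : IsIntegralForm R 0 1 1 :=
  ⟨⟨1, rfl⟩, by simp [QRep.one]⟩

theorem zero (K : ℤ) : IsIntegralForm R K 0 0 :=
  ⟨⟨0, rfl⟩, fun τ => by simp⟩

theorem congr_weight (h : IsIntegralForm R K F g) (hK : K = K') : IsIntegralForm R K' F g :=
  hK ▸ h

theorem pow (h : IsIntegralForm R K F g) (n : ℕ) : IsIntegralForm R (n * K) (F ^ n) (g ^ n) := by
  induction n with
  | zero => simpa using one
  | succ n ih =>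
    rw [pow_succ, pow_succ]
    exact (ih.mul h).congr_weight (by push_cast; ring)

theorem sum {ι : Type*} (s : Finset ι) {F : ι → ℍ → ℂ} {g : ι → PowerSeries R}
    (h : ∀ i ∈ s, IsIntegralForm R K (F i) (g i)) :
    IsIntegralForm R K (∑ i ∈ s, F i) (∑ i ∈ s, g i) := by
  classical
  induction s using Finset.induction_on with
  | empty => simpa using zero K
  | insert a s ha ih =>
    rw [Finset.sum_insert ha, Finset.sum_insert ha]
    exact (h a (by simp)).add (ih fun i hi => h i (by simp [hi]))

theorem map {S : Type*} [CommRing S] [Algebra S ℂ] [Algebra R S] [IsScalarTower R S ℂ]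
    (h : IsIntegralForm R K F g) : IsIntegralForm S K F (PowerSeries.map (algebraMap R S) g) := by
  refine ⟨h.1, ?_⟩
  rw [← RingHom.comp_apply, ← PowerSeries.map_comp, ← IsScalarTower.algebraMap_eq]
  exact h.2

end IsIntegralForm

end

section

open UpperHalfPlane ModularForm
open scoped MatrixGroups ArithmeticFunction.sigma

/-- The integral `q`-expansion of the Eisenstein series `E₂`. -/
def eisensteinSeriesTwo : PowerSeries ℤ := .mk fun n => if n = 0 then 1 else -24 * σ 1 n

/-- The integral `q`-expansion of the Eisenstein series `E₄`. -/
def eisensteinSeriesFour : PowerSeries ℤ := .mk fun n => if n = 0 then 1 else 240 * σ 3 n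

/-- The integral `q`-expansion of the Eisenstein series `E₆`. -/
def eisensteinSeriesSix : PowerSeries ℤ := .mk fun n => if n = 0 then 1 else -504 * σ 5 n

theorem isIntegralForm_E₄_int : IsIntegralForm ℤ 4 E₄ eisensteinSeriesFour := by
  refine ⟨⟨E₄, rfl⟩, ?_⟩
  convert QRep.modularForm E₄ using 1
  ext n
  rw [EisensteinSeries.E_qExpansion_coeff _ ⟨2, rfl⟩]
  simp only [eisensteinSeriesFour, PowerSeries.coeff_map, PowerSeries.coeff_mk]
  split_ifs <;> norm_num [show bernoulli 4 = -1 / 30 by decide +kernel]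

theorem isIntegralForm_E₆_int : IsIntegralForm ℤ 6 E₆ eisensteinSeriesSix := by
  refine ⟨⟨E₆, rfl⟩, ?_⟩
  convert QRep.modularForm E₆ using 1
  ext n
  rw [EisensteinSeries.E_qExpansion_coeff _ ⟨3, rfl⟩]
  simp only [eisensteinSeriesSix, PowerSeries.coeff_map, PowerSeries.coeff_mk]
  split_ifs <;> norm_num [show bernoulli 6 = 1 / 42 by decide +kernel]

section

variable (R : Type*) [CommRing R]

/-- The `q`-expansion of `E₄` over `R`. -/
noncomputable def serQ : PowerSeries R := PowerSeries.map (Int.castRingHom R) eisensteinSeriesFour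

/-- The `q`-expansion of `E₆` over `R`. -/
noncomputable def serR : PowerSeries R := PowerSeries.map (Int.castRingHom R) eisensteinSeriesSix

/-- The `q`-expansion of the discriminant `Δ` over `R`, where `c` is the inverse of `1728`. -/
noncomputable def serΔ {R : Type*} [CommRing R] (c : R) : PowerSeries R :=
  PowerSeries.C c * (serQ R ^ 3 - serR R ^ 2)

theorem map_serQ {S : Type*} [CommRing S] (φ : R →+* S) : PowerSeries.map φ (serQ R) = serQ S := by
  ext n; simp [serQ]

theorem map_serR {S : Type*} [CommRing S] (φ : R →+* S) : PowerSeries.map φ (serR R) = serR S := by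
  ext n; simp [serR]

theorem map_serΔ {S : Type*} [CommRing S] (φ : R →+* S) (c : R) :
    PowerSeries.map φ (serΔ c) = serΔ (φ c) := by
  simp [serΔ, map_serQ, map_serR]

theorem coeff_zero_serQ : PowerSeries.constantCoeff (serQ R) = 1 := by
  rw [← PowerSeries.coeff_zero_eq_constantCoeff_apply]
  simp [serQ, eisensteinSeriesFour, -PowerSeries.coeff_zero_eq_constantCoeff]

theorem coeff_zero_serR : PowerSeries.constantCoeff (serR R) = 1 := by
  rw [← PowerSeries.coeff_zero_eq_constantCoeff_apply]
  simp [serR, eisensteinSeriesSix, -PowerSeries.coeff_zero_eq_constantCoeff]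

theorem coeff_one_serQ : PowerSeries.coeff 1 (serQ R) = 240 := by
  simp [serQ, eisensteinSeriesFour]

theorem coeff_one_serR : PowerSeries.coeff 1 (serR R) = -504 := by
  simp [serR, eisensteinSeriesSix]

variable {R}

/-- `Δ` vanishes to first order in `q`, with leading coefficient one. -/
theorem exists_serΔ_eq {c : R} (hc : c * 1728 = 1) : ∃ ε : PowerSeries R,
    serΔ c = PowerSeries.X * ε ∧ PowerSeries.constantCoeff ε = 1 := by
  have h0 : PowerSeries.constantCoeff (serΔ c) = 0 := by
    simp [serΔ, coeff_zero_serQ, coeff_zero_serR]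
  obtain ⟨ε, hε⟩ := PowerSeries.X_dvd_iff.2 h0
  refine ⟨ε, hε, ?_⟩
  have h1 : PowerSeries.coeff 1 (serΔ c) = 1 := by
    rw [serΔ, PowerSeries.coeff_C_mul, ← hc]
    congr 1
    simp only [pow_succ, pow_zero, one_mul, map_sub, PowerSeries.coeff_one_mul, 
      coeff_zero_serQ, coeff_zero_serR, coeff_one_serQ, coeff_one_serR, map_mul]
    norm_num
  rw [hε, show (1 : ℕ) = 0 + 1 from rfl, PowerSeries.coeff_succ_X_mul] at h1
  simpa using h1

variable [Algebra R ℂ]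

theorem isIntegralForm_E₄ : IsIntegralForm R 4 E₄ (serQ R) := isIntegralForm_E₄_int.map

theorem isIntegralForm_E₆ : IsIntegralForm R 6 E₆ (serR R) := isIntegralForm_E₆_int.map

theorem isIntegralForm_discriminant {c : R} (hc : c * 1728 = 1) :
    IsIntegralForm R 12 discriminant (serΔ c) := by
  convert! (((isIntegralForm_E₄ (R := R)).pow 3).sub
    (((isIntegralForm_E₆ (R := R)).pow 2).congr_weight (by norm_num))).smul c using 1
  ext τ
  have : algebraMap R ℂ c * 1728 = 1 := by
    rw [← map_one (algebraMap R ℂ), ← hc, map_mul, map_ofNat]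
  simp only [Pi.smul_apply, Pi.sub_apply, Pi.pow_apply, smul_eq_mul]
  rw [discriminant_eq_E₄_cube_sub_E₆_sq, div_eq_iff (by norm_num), mul_assoc, mul_comm _ (1728 : ℂ),
    ← mul_assoc, this, one_mul]

end

namespace IsIntegralForm

variable {R : Type*} [CommRing R] [Algebra R ℂ] {K : ℤ} {F : ℍ → ℂ} {g : PowerSeries R}

theorem qExpansion_eq {f : ModularForm 𝒮ℒ K} (h : IsIntegralForm R K f g) :
    qExpansion 1 f = PowerSeries.map (algebraMap R ℂ) g :=
  QRep.unique f one_pos (by simpa using QRep.modularForm f) (by simpa using h.2)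

/-- A form whose constant coefficient vanishes is divisible by the discriminant. -/
theorem exists_eq_discriminant_mul [FaithfulSMul R ℂ] {c : R} (hc : c * 1728 = 1)
    (h : IsIntegralForm R K F g) (h0 : PowerSeries.constantCoeff g = 0) :
    ∃ F' g', IsIntegralForm R (K - 12) F' g' ∧ F = discriminant * F' ∧ g = serΔ c * g' := by
  obtain ⟨f, rfl⟩ := h.1
  have hq := h.qExpansion_eq
  have hf0 : (qExpansion 1 f).coeff 0 = 0 := by
    rw [hq]; simp [h0]
  set f' := CuspForm.discriminantEquiv (toCuspForm f hf0) with hf'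
  have hF : (f : ℍ → ℂ) = discriminant * f' := (discriminant_mul_discriminantEquiv (toCuspForm f hf0)).symm
  obtain ⟨ε, hε, hε1⟩ := exists_serΔ_eq hc
  obtain ⟨g₁, hg₁⟩ := PowerSeries.X_dvd_iff.2 h0
  obtain ⟨w, hw⟩ : IsUnit ε := by
    rw [PowerSeries.isUnit_iff_constantCoeff, hε1]
    exact isUnit_one
  have hgg : g = serΔ c * (((w⁻¹ : (PowerSeries R)ˣ) : PowerSeries R) * g₁) := by
    rw [hε, hg₁, ← hw]
    have := w.mul_inv
    linear_combination (-PowerSeries.X * g₁) * this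
  refine ⟨f', _, ⟨⟨f', rfl⟩, ?_⟩, hF, hgg⟩
  have key : PowerSeries.map (algebraMap R ℂ) g =
      PowerSeries.map (algebraMap R ℂ) (serΔ c) * qExpansion 1 f' := by
    rw [← hq]
    refine QRep.unique f one_pos (by simpa using QRep.modularForm f) ?_
    rw [hF]
    simpa using (isIntegralForm_discriminant hc).2.mul (QRep.modularForm f')
  rw [hgg, map_mul] at key
  have hne : PowerSeries.map (algebraMap R ℂ) (serΔ c) ≠ 0 := by
    intro h
    have := congrArg (PowerSeries.coeff 1) h
    rw [PowerSeries.coeff_map, hε, show (1 : ℕ) = 0 + 1 from rfl, PowerSeries.coeff_succ_X_mul] at this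
    simp [hε1] at this
  rw [mul_left_cancel₀ hne key]
  exact QRep.modularForm f'

end IsIntegralForm

end

section

open UpperHalfPlane ModularForm
open scoped MatrixGroups

/-- Power series with coefficients up to order `n` in the ideal `I` remain so after division by a
power series `X * ε` with `ε` of constant coefficient one. -/
theorem coeff_mem_of_mul {R : Type*} [CommRing R] {I : Ideal R} {ε g g' : PowerSeries R} {s : ℕ}
    (hε : PowerSeries.constantCoeff ε = 1) (hg : g = PowerSeries.X * ε * g')
    (h : ∀ n < s + 1, PowerSeries.coeff n g ∈ I) : ∀ n < s, PowerSeries.coeff n g' ∈ I := by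
  intro n
  induction n using Nat.strong_induction_on with
  | _ n ih =>
    intro hn
    have h1 := h (n + 1) (by omega)
    rw [hg, mul_assoc, PowerSeries.coeff_succ_X_mul, PowerSeries.coeff_mul,
      Finset.Nat.sum_antidiagonal_eq_sum_range_succ_mk, Finset.sum_range_succ'] at h1
    simp only [PowerSeries.coeff_zero_eq_constantCoeff, hε, one_mul, Nat.sub_zero] at h1
    refine (Ideal.add_mem_iff_right I (I.sum_mem fun i hi => ?_)).1 h1
    have := Finset.mem_range.1 hi
    exact I.mul_mem_left _ (ih _ (by omega) (by omega))

namespace IsIntegralForm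

variable {R : Type*} [CommRing R] [Algebra R ℂ] {K : ℤ} {F : ℍ → ℂ} {g : PowerSeries R}

theorem eq_zero_of_weight (h : IsIntegralForm R K F g) (hK : K < 0 ∨ Odd K ∨ K = 2) : F = 0 := by
  obtain ⟨⟨f, rfl⟩, -⟩ := h
  rcases hK with hK | hK | rfl
  · exact ModularFormClass.levelOne_neg_weight_eq_zero hK f
  · rw [levelOne_odd_weight_eq_zero hK f]; rfl
  · rw [rank_zero_iff_forall_zero.1 levelOne_weight_two_rank_zero f]; rfl

/-- If the initial `q`-expansion coefficients of a form lie in an ideal, then so does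
its value on any integral lattice. -/
theorem exists_mem_eq [FaithfulSMul R ℂ] {c : R} (hc : c * 1728 = 1) {l : ℂ} (hl : l ≠ 0) {τ : ℍ}
    {A B : R} (hA : algebraMap R ℂ A = l ^ 4 * E₄ τ) (hB : algebraMap R ℂ B = l ^ 6 * E₆ τ)
    (I : Ideal R) (h : IsIntegralForm R K F g) {s : ℕ} (hs : K < 12 * s)
    (hI : ∀ n < s, PowerSeries.coeff n g ∈ I) : ∃ v ∈ I, algebraMap R ℂ v = l ^ K * F τ := by
  induction s generalizing K F g with
  | zero =>
    refine ⟨0, I.zero_mem, ?_⟩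
    rw [h.eq_zero_of_weight (Or.inl (by simpa using hs))]
    simp
  | succ s ih =>
    by_cases hK : K < 0 ∨ Odd K ∨ K = 2
    · refine ⟨0, I.zero_mem, ?_⟩
      rw [h.eq_zero_of_weight hK]
      simp
    obtain ⟨i, j, hij⟩ : ∃ i j : ℕ, K = i * 4 + j * 6 := by
      push Not at hK
      obtain ⟨h0, hodd, h2⟩ := hK
      obtain ⟨m, rfl⟩ := Int.not_odd_iff_even.1 hodd
      rcases Int.even_or_odd m with ⟨r, rfl⟩ | ⟨r, rfl⟩
      · exact ⟨r.toNat, 0, by omega⟩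
      · exact ⟨(r - 1).toNat, 1, by omega⟩
    have hM : IsIntegralForm R K (E₄ ^ i * E₆ ^ j : ℍ → ℂ) (serQ R ^ i * serR R ^ j) :=
      ((isIntegralForm_E₄.pow i).mul (isIntegralForm_E₆.pow j)).congr_weight hij.symm
    set c₀ := PowerSeries.constantCoeff g with hc₀
    have hc₀I : c₀ ∈ I := by simpa using hI 0 (by omega)
    obtain ⟨F', g', hF', hFF', hgg'⟩ := (h.sub (hM.smul c₀)).exists_eq_discriminant_mul hc (by
      simp [coeff_zero_serQ, coeff_zero_serR, hc₀])
    obtain ⟨ε, hε, hε1⟩ := exists_serΔ_eq hc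
    rw [hε] at hgg'
    obtain ⟨v, hvI, hv⟩ := ih hF' (by push_cast at hs; omega)
      (coeff_mem_of_mul hε1 hgg' fun n hn => by
        rw [map_sub, PowerSeries.coeff_C_mul]
        exact I.sub_mem (hI n hn) (I.mul_mem_right _ hc₀I))
    refine ⟨c₀ * (A ^ i * B ^ j) + (c * (A ^ 3 - B ^ 2)) * v,
      I.add_mem (I.mul_mem_right _ hc₀I) (I.mul_mem_left _ hvI), ?_⟩
    have hFτ : F τ = algebraMap R ℂ c₀ * (E₄ τ ^ i * E₆ τ ^ j) + discriminant τ * F' τ := by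
      have := congrFun hFF' τ
      simp only [Pi.sub_apply, Pi.smul_apply, Pi.mul_apply, Pi.pow_apply, smul_eq_mul] at this
      linear_combination this
    have hc' : algebraMap R ℂ c * 1728 = 1 := by
      rw [← map_one (algebraMap R ℂ), ← hc, map_mul, map_ofNat]
    have hlK : l ^ K = (l ^ 4) ^ i * (l ^ 6) ^ j := by
      rw [hij, zpow_add₀ hl, zpow_mul', zpow_mul']
      norm_cast
    have hlK' : l ^ K = l ^ 12 * l ^ (K - 12) := by
      rw [← zpow_natCast, ← zpow_add₀ hl]
      congr 1
      push_cast; ring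
    have hΔ : algebraMap R ℂ c * ((l ^ 4 * E₄ τ) ^ 3 - (l ^ 6 * E₆ τ) ^ 2) =
        l ^ 12 * discriminant τ := by
      rw [discriminant_eq_E₄_cube_sub_E₆_sq]
      linear_combination (l ^ 12 * (E₄ τ ^ 3 - E₆ τ ^ 2) / 1728) * hc'
    rw [hFτ, mul_add]
    simp only [map_add, map_mul, map_sub, map_pow, hA, hB, hv]
    rw [hΔ]
    nth_rw 1 [hlK]
    rw [hlK']
    ring

end IsIntegralForm

end

section

open UpperHalfPlane ModularForm Derivative
open scoped MatrixGroups Manifold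

/-- The derivation `q d/dq` on power series. -/
noncomputable def qDeriv (R : Type*) [CommRing R] : Derivation R (PowerSeries R) (PowerSeries R) :=
  (PowerSeries.X : PowerSeries R) • PowerSeries.derivative R

theorem coeff_qDeriv {R : Type*} [CommRing R] (g : PowerSeries R) (n : ℕ) :
    PowerSeries.coeff n (qDeriv R g) = n * PowerSeries.coeff n g := by
  cases n with
  | zero => simp [qDeriv]
  | succ n =>
    simp only [qDeriv, Derivation.smul_apply, smul_eq_mul, PowerSeries.coeff_succ_X_mul,
      PowerSeries.coeff_derivative]
    push_cast; ring

theorem map_qDeriv {R S : Type*} [CommRing R] [CommRing S] (φ : R →+* S) (g : PowerSeries R) :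
    PowerSeries.map φ (qDeriv R g) = qDeriv S (PowerSeries.map φ g) := by
  ext n; simp [coeff_qDeriv]

namespace QRep

variable {N : ℝ} {F : ℍ → ℂ} {G : PowerSeries ℂ}

theorem summable_bound (hN : 0 < N) (h : QRep N F G) {y : ℝ} (hy : 0 < y) :
    ∃ u : ℕ → ℝ, Summable u ∧ ∀ n, ∀ w ∈ {w : ℂ | y < w.im},
      ‖PowerSeries.coeff n G * Function.Periodic.qParam N w ^ n‖ ≤ u n := by
  have hy' : 0 < ((y : ℂ) * Complex.I).im := by simpa using hy
  refine ⟨_, (h ⟨y * Complex.I, hy'⟩).summable.norm, fun n w hw => ?_⟩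
  rw [norm_mul, norm_mul, norm_pow, norm_pow]
  refine mul_le_mul_of_nonneg_left (pow_le_pow_left₀ (norm_nonneg _) ?_ n) (norm_nonneg _)
  rw [Function.Periodic.norm_qParam, Function.Periodic.norm_qParam]
  have hw' : y < w.im := hw
  have : ((y : ℂ) * Complex.I).im = y := by simp
  refine Real.exp_le_exp.2 (div_le_div_of_nonneg_right ?_ hN.le)
  rw [UpperHalfPlane.coe_mk, this]
  nlinarith [Real.pi_pos]

theorem eventuallyEq (h : QRep N F G) (τ : ℍ) : (F ∘ ofComplex) =ᶠ[nhds (τ : ℂ)]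
    fun w => ∑' n, PowerSeries.coeff n G * Function.Periodic.qParam N w ^ n := by
  filter_upwards [isOpen_upperHalfPlaneSet.mem_nhds τ.im_pos] with w hw
  rw [Function.comp_apply, ofComplex_apply_of_im_pos hw]
  exact (h ⟨w, hw⟩).tsum_eq.symm

theorem mem_halfPlane (τ : ℍ) : (τ : ℂ) ∈ {w : ℂ | τ.im / 2 < w.im} := by
  have := τ.im_pos
  simp only [Set.mem_ofPred_eq, coe_im]
  linarith

theorem isOpen_halfPlane (y : ℝ) : IsOpen {w : ℂ | y < w.im} :=
  isOpen_lt continuous_const Complex.continuous_im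

theorem differentiable_term (N : ℝ) (G : PowerSeries ℂ) (n : ℕ) : Differentiable ℂ fun w : ℂ =>
    PowerSeries.coeff n G * Function.Periodic.qParam N w ^ n := by
  unfold Function.Periodic.qParam
  fun_prop

theorem mdifferentiable (hN : 0 < N) (h : QRep N F G) : MDiff F := by
  intro τ
  rw [UpperHalfPlane.mdifferentiableAt_iff]
  obtain ⟨u, hu, hle⟩ := h.summable_bound hN (half_pos τ.im_pos)
  have := Complex.differentiableOn_tsum_of_summable_norm hu
    (fun n => (differentiable_term N G n).differentiableOn) (isOpen_halfPlane _) hle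
  exact (h.eventuallyEq τ).differentiableAt_iff.2
    (this.differentiableAt ((isOpen_halfPlane _).mem_nhds (mem_halfPlane τ)))

theorem normalizedDeriv (h : QRep 1 F G) : QRep 1 (D F) (qDeriv ℂ G) := fun τ => by
  obtain ⟨u, hu, hle⟩ := h.summable_bound one_pos (half_pos τ.im_pos)
  have := Complex.hasSum_deriv_of_summable_norm hu
    (fun n => (differentiable_term 1 G n).differentiableOn) (isOpen_halfPlane _) hle
    (mem_halfPlane τ)
  rw [← (h.eventuallyEq τ).deriv_eq] at this
  rw [normalizedDerivOfComplex]
  have hs := this.mul_left (2 * Real.pi * Complex.I)⁻¹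
  refine (funext fun n => ?_ : (fun n => PowerSeries.coeff n (qDeriv ℂ G) *
    Function.Periodic.qParam 1 τ ^ n) = _) ▸ hs
  have hq : HasDerivAt (fun w : ℂ => PowerSeries.coeff n G * Function.Periodic.qParam 1 w ^ n)
      (PowerSeries.coeff n G * (n * (2 * Real.pi * Complex.I) *
        Function.Periodic.qParam 1 τ ^ n)) τ := by
    have e : (fun w : ℂ => PowerSeries.coeff n G * Function.Periodic.qParam 1 w ^ n) =
        fun w => PowerSeries.coeff n G * Complex.exp (n * (2 * Real.pi * Complex.I) * w) := by
      ext w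
      rw [Function.Periodic.qParam, ← Complex.exp_nat_mul]
      congr 2
      simp; ring
    rw [e]
    have h1 := ((hasDerivAt_id (τ : ℂ)).const_mul (n * (2 * Real.pi * Complex.I))).cexp.const_mul
      (PowerSeries.coeff n G)
    convert! h1 using 1
    rw [Function.Periodic.qParam, ← Complex.exp_nat_mul]
    simp only [id, mul_one, Complex.ofReal_one, div_one]
    rw [mul_comm (Complex.exp _)]
    ring_nf
  rw [hq.deriv, coeff_qDeriv]
  have := Complex.two_pi_I_ne_zero
  field_simp

/-- A function invariant under the generators of `SL₂(ℤ)` and given by a power series in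
`exp (2πiτ/N)` is a modular form. -/
theorem exists_modularForm (hN : 0 < N) (h : QRep N F G) {k : ℤ}
    (hS : F ∣[k] ModularGroup.S = F) (hT : F ∣[k] ModularGroup.T = F) :
    ∃ f : ModularForm 𝒮ℒ k, ⇑f = F := by
  have hγ := SlashInvariantForm.slash_action_generators_SL2Z hS hT
  refine ⟨⟨⟨F, ?_⟩, h.mdifferentiable hN, ?_⟩, rfl⟩
  · rintro _ ⟨γ, rfl⟩
    exact hγ γ
  · intro c hc
    rw [OnePoint.isBoundedAt_iff_forall_SL2Z hc]
    intro γ _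
    rw [hγ γ]
    exact h.isBoundedAtImInfty hN

end QRep

end

section

open UpperHalfPlane ModularForm Derivative
open scoped MatrixGroups Manifold ArithmeticFunction.sigma

/-- The integral `q`-expansion of the Eisenstein series `E₂`. -/
noncomputable def serP (R : Type*) [CommRing R] : PowerSeries R :=
  PowerSeries.map (Int.castRingHom R) eisensteinSeriesTwo

theorem map_serP {R S : Type*} [CommRing R] [CommRing S] (φ : R →+* S) :
    PowerSeries.map φ (serP R) = serP S := by
  ext n; simp [serP]

theorem coeff_zero_serP (R : Type*) [CommRing R] : PowerSeries.constantCoeff (serP R) = 1 := by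
  rw [← PowerSeries.coeff_zero_eq_constantCoeff_apply]
  simp [serP, eisensteinSeriesTwo, -PowerSeries.coeff_zero_eq_constantCoeff]

theorem constantCoeff_qDeriv {R : Type*} [CommRing R] (g : PowerSeries R) :
    PowerSeries.constantCoeff (qDeriv R g) = 0 := by
  rw [← PowerSeries.coeff_zero_eq_constantCoeff_apply, coeff_qDeriv]
  simp

theorem qRep_E2 : QRep 1 EisensteinSeries.E2 (serP ℂ) := fun τ => by
  convert! EisensteinSeries.hasSum_qExpansion_E2 (z := τ) using 1
  ext n
  simp [serP, eisensteinSeriesTwo, Function.Periodic.qParam]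

theorem IsIntegralForm.mdifferentiable {R : Type*} [CommRing R] [Algebra R ℂ] {K : ℤ} {F : ℍ → ℂ}
    {g : PowerSeries R} (h : IsIntegralForm R K F g) : MDiff F :=
  h.2.mdifferentiable one_pos

theorem IsIntegralForm.serreDerivative {K : ℤ} {F : ℍ → ℂ} {g : PowerSeries ℂ}
    (h : IsIntegralForm ℂ K F g) : IsIntegralForm ℂ (K + 2) (serreDerivative K F)
      (qDeriv ℂ g - ((K : ℂ) / 12) • (serP ℂ * g)) := by
  have hq : QRep 1 F g := by simpa using h.2
  have h1 : QRep 1 (Derivative.serreDerivative K F)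
      (qDeriv ℂ g - ((K : ℂ) / 12) • (serP ℂ * g)) := by
    convert! hq.normalizedDeriv.sub ((qRep_E2.mul hq).smul ((K : ℂ) / 12)) using 1
    ext τ
    simp [serreDerivative_apply, div_eq_mul_inv, mul_assoc]
  refine ⟨h1.exists_modularForm one_pos ?_ ?_, by simpa using h1⟩ <;>
  · obtain ⟨f, rfl⟩ := h.1
    refine serreDerivative_slash_invariant h.mdifferentiable ?_
    exact SlashInvariantForm.slash_action_eqn f _ ⟨_, rfl⟩

theorem IsIntegralForm.series_unique {R : Type*} [CommRing R] [Algebra R ℂ] [FaithfulSMul R ℂ]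
    {K : ℤ} {F : ℍ → ℂ} {g g' : PowerSeries R} (h : IsIntegralForm R K F g)
    (h' : IsIntegralForm R K F g') : g = g' := by
  obtain ⟨f, rfl⟩ := h.1
  exact PowerSeries.map_injective _ (FaithfulSMul.algebraMap_injective R ℂ)
    (h.qExpansion_eq.symm.trans h'.qExpansion_eq)

theorem IsIntegralForm.eq_zero_of_constantCoeff {K : ℤ} (hK : K < 12) {F : ℍ → ℂ}
    {g : PowerSeries ℂ} (h : IsIntegralForm ℂ K F g) (h0 : PowerSeries.constantCoeff g = 0) :
    g = 0 := by
  obtain ⟨F', g', h', -, rfl⟩ := h.exists_eq_discriminant_mul (c := 1 / 1728) (by norm_num) h0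
  obtain rfl := h'.eq_zero_of_weight (Or.inl (by omega))
  rw [h'.series_unique (IsIntegralForm.zero _), mul_zero]

theorem isIntegralForm_deriv_E2 : IsIntegralForm ℂ 4
    (D EisensteinSeries.E2 - (1 / 12 : ℂ) • EisensteinSeries.E2 ^ 2)
    (qDeriv ℂ (serP ℂ) - (1 / 12 : ℂ) • serP ℂ ^ 2) := by
  have h1 : QRep 1 (D EisensteinSeries.E2 - (1 / 12 : ℂ) • EisensteinSeries.E2 ^ 2)
      (qDeriv ℂ (serP ℂ) - (1 / 12 : ℂ) • serP ℂ ^ 2) :=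
    qRep_E2.normalizedDeriv.sub ((qRep_E2.pow 2).smul _)
  have key : ∀ γ : SL(2, ℤ), (D EisensteinSeries.E2 - (1 / 12 : ℂ) • EisensteinSeries.E2 ^ 2)
      ∣[(4 : ℤ)] γ = D EisensteinSeries.E2 - (1 / 12 : ℂ) • EisensteinSeries.E2 ^ 2 := by
    intro γ
    have hE : MDiff EisensteinSeries.E2 := E2_mdifferentiable
    have hD := normalizedDerivOfComplex_SL_slash (k := 2) hE (γ := γ)
    have hs : ∀ z : ℍ, HasDerivAt ((EisensteinSeries.D2 γ) ∘ ofComplex)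
        (2 * Real.pi * Complex.I * γ 1 0 * (- γ 1 0 / denom γ z ^ 2)) z := by
      intro z
      have h1 := (hasDerivAt_denom_zpow (γ : GL (Fin 2) ℝ) (-1) z).const_mul
        (2 * Real.pi * Complex.I * γ 1 0)
      have h2 := h1.congr_of_eventuallyEq (f₁ := (EisensteinSeries.D2 γ) ∘ ofComplex) (by
        filter_upwards [isOpen_upperHalfPlaneSet.mem_nhds z.im_pos] with w hw
        simp [EisensteinSeries.D2, ofComplex_apply_of_im_pos hw, div_eq_mul_inv])
      convert! h2 using 1
      simp [div_eq_mul_inv, zpow_neg]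
    have hsD : MDiff (EisensteinSeries.D2 γ) := fun z =>
      UpperHalfPlane.mdifferentiableAt_iff.2 (hs z).differentiableAt
    have hE2 := EisensteinSeries.E2_slash_action γ
    rw [hE2, normalizedDerivOfComplex_sub _ _ hE (hsD.const_smul _),
      normalizedDerivOfComplex_smul _ _ hsD] at hD
    ext z
    have hD' := congrFun hD z
    have hE2' := congrFun hE2 z
    have hm := congrFun (ModularForm.mul_slash_SL2 2 2 γ EisensteinSeries.E2 EisensteinSeries.E2) z
    have hDs : (D (EisensteinSeries.D2 γ)) z = - (γ 1 0 : ℂ) ^ 2 / denom γ z ^ 2 := by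
      rw [normalizedDerivOfComplex, (hs z).deriv]
      have := Complex.two_pi_I_ne_zero
      field_simp
    simp only [Pi.sub_apply, Pi.smul_apply, Pi.mul_apply, smul_eq_mul, riemannZeta_two, hDs,
      EisensteinSeries.D2, hE2'] at hD' hm
    rw [sub_eq_add_neg, SlashAction.add_slash, SlashAction.neg_slash, SL_smul_slash, pow_two]
    simp only [Pi.add_apply, Pi.neg_apply, Pi.smul_apply, Pi.mul_apply, smul_eq_mul]
    change (D EisensteinSeries.E2 ∣[(4 : ℤ)] γ) z + -(1 / 12 *
      ((EisensteinSeries.E2 * EisensteinSeries.E2) ∣[(4 : ℤ)] γ) z) = _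
    norm_num at hm hD'
    rw [hm]
    have hπ : (Real.pi : ℂ) ≠ 0 := by exact_mod_cast Real.pi_ne_zero
    have hd := denom_ne_zero (γ : GL (Fin 2) ℝ) z
    have hI := Complex.I_sq
    have e : (D EisensteinSeries.E2 ∣[(4 : ℤ)] γ) z = D EisensteinSeries.E2 z +
        3 * (γ 1 0 : ℂ) ^ 2 / (Real.pi ^ 2 * denom γ z ^ 2) - Complex.I * γ 1 0 /
          (Real.pi * denom γ z) * (EisensteinSeries.E2 z -
            6 * Complex.I * γ 1 0 / (Real.pi * denom γ z)) := by
      rw [sub_eq_iff_eq_add] at hD'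
      rw [hD']
      field_simp
      ring
    rw [e]
    generalize denom (γ : GL (Fin 2) ℝ) z = d at *
    generalize (γ 1 0 : ℂ) = c at *
    field_simp
    linear_combination (36 * c ^ 2) * hI
  exact ⟨h1.exists_modularForm one_pos (key _) (key _), by simpa using h1⟩

end

section

open UpperHalfPlane ModularForm Derivative
open scoped MatrixGroups Manifold ArithmeticFunction.sigma

theorem qDeriv_serQ_complex :
    qDeriv ℂ (serQ ℂ) = (1 / 3 : ℂ) • (serP ℂ * serQ ℂ - serR ℂ) := by
  have h := (isIntegralForm_E₄ (R := ℂ)).serreDerivative.add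
    (((isIntegralForm_E₆ (R := ℂ)).smul (1 / 3)).congr_weight (by norm_num))
  have h0 := h.eq_zero_of_constantCoeff (by norm_num) (by
    simp [PowerSeries.smul_eq_C_mul, constantCoeff_qDeriv, coeff_zero_serP, coeff_zero_serQ,
      coeff_zero_serR]
    norm_num)
  rw [← PowerSeries.smul_eq_C_mul] at h0
  have e : ((4 : ℤ) : ℂ) / 12 = 1 / 3 := by norm_num
  rw [e] at h0
  rw [smul_sub]
  linear_combination h0

theorem qDeriv_serR_complex :
    qDeriv ℂ (serR ℂ) = (1 / 2 : ℂ) • (serP ℂ * serR ℂ - serQ ℂ ^ 2) := by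
  have h := (isIntegralForm_E₆ (R := ℂ)).serreDerivative.add
    ((((isIntegralForm_E₄ (R := ℂ)).pow 2).smul (1 / 2)).congr_weight (by norm_num))
  have h0 := h.eq_zero_of_constantCoeff (by norm_num) (by
    simp [PowerSeries.smul_eq_C_mul, constantCoeff_qDeriv, coeff_zero_serP, coeff_zero_serQ,
      coeff_zero_serR]
    norm_num)
  rw [← PowerSeries.smul_eq_C_mul] at h0
  have e : ((6 : ℤ) : ℂ) / 12 = 1 / 2 := by norm_num
  rw [e] at h0
  rw [smul_sub]
  linear_combination h0

theorem qDeriv_serP_complex :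
    qDeriv ℂ (serP ℂ) = (1 / 12 : ℂ) • (serP ℂ ^ 2 - serQ ℂ) := by
  have h := isIntegralForm_deriv_E2.add ((isIntegralForm_E₄ (R := ℂ)).smul (1 / 12))
  have h0 := h.eq_zero_of_constantCoeff (by norm_num) (by
    simp [PowerSeries.smul_eq_C_mul, constantCoeff_qDeriv, coeff_zero_serP, coeff_zero_serQ])
  rw [← PowerSeries.smul_eq_C_mul] at h0
  rw [smul_sub]
  linear_combination h0

theorem eq_of_map_complex {f g : PowerSeries ℤ}
    (h : PowerSeries.map (Int.castRingHom ℂ) f = PowerSeries.map (Int.castRingHom ℂ) g) : f = g :=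
  PowerSeries.map_injective _ (RingHom.injective_int _) h

/-- Ramanujan's differential equation for `E₄`. -/
theorem qDeriv_serQ (R : Type*) [CommRing R] : 3 * qDeriv R (serQ R) = serP R * serQ R - serR R := by
  have : 3 * qDeriv ℤ (serQ ℤ) = serP ℤ * serQ ℤ - serR ℤ := eq_of_map_complex (by
    simp only [map_mul, map_sub, map_qDeriv, map_serQ, map_serP, map_serR, map_ofNat,
      qDeriv_serQ_complex]
    rw [PowerSeries.smul_eq_C_mul, ← mul_assoc, ← map_ofNat PowerSeries.C 3, ← map_mul]
    norm_num)
  simpa [map_qDeriv, map_ofNat, map_serQ, map_serP, map_serR] using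
    congrArg (PowerSeries.map (Int.castRingHom R)) this

/-- Ramanujan's differential equation for `E₆`. -/
theorem qDeriv_serR (R : Type*) [CommRing R] :
    2 * qDeriv R (serR R) = serP R * serR R - serQ R ^ 2 := by
  have : 2 * qDeriv ℤ (serR ℤ) = serP ℤ * serR ℤ - serQ ℤ ^ 2 := eq_of_map_complex (by
    simp only [map_mul, map_sub, map_pow, map_qDeriv, map_serQ, map_serP, map_serR, map_ofNat,
      qDeriv_serR_complex]
    rw [PowerSeries.smul_eq_C_mul, ← mul_assoc, ← map_ofNat PowerSeries.C 2, ← map_mul]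
    norm_num)
  simpa [map_qDeriv, map_ofNat, map_serQ, map_serP, map_serR] using
    congrArg (PowerSeries.map (Int.castRingHom R)) this

/-- Ramanujan's differential equation for `E₂`. -/
theorem qDeriv_serP (R : Type*) [CommRing R] :
    12 * qDeriv R (serP R) = serP R ^ 2 - serQ R := by
  have : 12 * qDeriv ℤ (serP ℤ) = serP ℤ ^ 2 - serQ ℤ := eq_of_map_complex (by
    simp only [map_mul, map_sub, map_pow, map_qDeriv, map_serQ, map_serP, map_ofNat,
      qDeriv_serP_complex]
    rw [PowerSeries.smul_eq_C_mul, ← mul_assoc, ← map_ofNat PowerSeries.C 12, ← map_mul]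
    norm_num)
  simpa [map_qDeriv, map_ofNat, map_serQ, map_serP] using
    congrArg (PowerSeries.map (Int.castRingHom R)) this

end

section

open UpperHalfPlane ModularForm Derivative
open scoped MatrixGroups Manifold ArithmeticFunction.sigma

open Polynomial in
/-- The derivation on polynomials acting by `d` on the coefficients. -/
noncomputable def coeffDerivation {k A : Type*} [CommRing k] [CommRing A] [Algebra k A]
    (d : Derivation k A A) : Derivation k A[X] A[X] :=
  ((PolynomialModule.equivPolynomialSelf (R := A)).toLinearMap).compDer d.mapCoeffs

open Polynomial

variable {k A : Type*} [CommRing k] [CommRing A] [Algebra k A] (d : Derivation k A A)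

theorem coeff_coeffDerivation (f : A[X]) (n : ℕ) :
    (coeffDerivation d f).coeff n = d (f.coeff n) := rfl

theorem coeffDerivation_C (a : A) : coeffDerivation d (C a) = C (d a) := by
  ext n
  rw [coeff_coeffDerivation, coeff_C, coeff_C]
  split_ifs <;> simp

theorem coeffDerivation_X : coeffDerivation d (X : A[X]) = 0 := by
  ext n
  rw [coeff_coeffDerivation, coeff_X]
  split_ifs <;> simp

theorem coeffDerivation_linear (a b : A) :
    coeffDerivation d (C a * X + C b) = C (d a) * X + C (d b) := by
  rw [map_add, Derivation.leibniz, coeffDerivation_C, coeffDerivation_C, coeffDerivation_X,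
    smul_zero, zero_add, smul_eq_mul, X_mul_C]

theorem coeffDerivation_shortCubic (α β : A) :
    coeffDerivation d (shortCubic α β) = C (d α) * X + C (d β) := by
  rw [shortCubic, add_assoc, map_add, coeffDerivation_linear, Derivation.leibniz_pow,
    coeffDerivation_X, smul_zero, smul_zero, zero_add]

theorem derivation_derivation_pow (f : A) (n : ℕ) :
    d (d (f ^ (n + 2))) = (n + 2) * ((n + 1) * f ^ n * d f ^ 2 + f ^ (n + 1) * d (d f)) := by
  rw [Derivation.leibniz_pow, map_nsmul, show n + 2 - 1 = n + 1 from rfl]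
  simp only [smul_eq_mul, nsmul_eq_mul, Derivation.leibniz, Derivation.leibniz_pow,
    Nat.add_sub_cancel]
  push_cast
  ring

/-- If the powers of a cubic satisfy a second order equation up to an exact differential,
then the Hasse invariant is annihilated by the square of the derivation. -/
theorem derivation_derivation_hasseInvariant {p : ℕ} (hp : 5 ≤ p) (hodd : p % 2 = 1) [CharP A p]
    (α β : A) (G : A[X])
    (hG : 3 * (C (d α) * X + C (d β)) ^ 2 - 2 * (shortCubic α β * (C (d (d α)) * X + C (d (d β)))) =
      -6 * (derivative (shortCubic α β) * G) + 4 * (shortCubic α β * derivative G)) :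
    d (d (hasseInvariant p α β)) = 0 := by
  obtain ⟨n, hn⟩ : ∃ n, p / 2 = n + 2 := ⟨p / 2 - 2, by omega⟩
  have hp2 : p = 2 * n + 5 := by omega
  have h0 : (p : A) = 0 := CharP.cast_eq_zero _ _
  have h2 : (2 * (n : A[X]) + 5) = 0 := by
    have : (p : A[X]) = 0 := by rw [← C_eq_natCast, h0, C_0]
    rw [hp2] at this
    exact_mod_cast this
  have key : 4 * coeffDerivation d (coeffDerivation d (shortCubic α β ^ (n + 2))) =
      4 * derivative (shortCubic α β ^ (n + 1) * G) := by
    rw [derivation_derivation_pow, coeffDerivation_shortCubic, coeffDerivation_linear,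
      derivative_mul, derivative_pow, Nat.add_sub_cancel, map_natCast]
    push_cast
    linear_combination shortCubic α β ^ n * hG +
      (shortCubic α β ^ n * (C (d α) * X + C (d β)) ^ 2 * (2 * n + 1) +
        2 * shortCubic α β ^ (n + 1) * (C (d (d α)) * X + C (d (d β))) -
        2 * shortCubic α β ^ n * derivative (shortCubic α β) * G) * h2
  have h := congrArg (fun f => coeff f (p - 1)) key
  simp only [coeff_ofNat_mul, coeff_coeffDerivation, coeff_derivative] at h
  have h1 : ((p - 1 : ℕ) : A) + 1 = 0 := by
    rw [← h0, ← Nat.cast_succ]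
    congr 1
    omega
  rw [h1, mul_zero, mul_zero] at h
  rw [hasseInvariant, hn]
  have h3 : 2 * ((n : A) + 2) = -1 := by
    rw [hp2] at h0
    push_cast at h0
    linear_combination h0
  linear_combination ((n : A) + 2) ^ 2 * h -
    d (d (coeff (shortCubic α β ^ (n + 2)) (p - 1))) * (2 * ((n : A) + 2) - 1) * h3

/-- A differential system of Ramanujan type forces a second order equation for the Hasse
invariant. -/
theorem derivation_derivation_hasseInvariant_of_system {p : ℕ} (hp : 5 ≤ p) (hodd : p % 2 = 1)
    [CharP A p] {s a b : A} (hs : d s = s ^ 2 + a) (ha : d a = 4 * s * a + 2 * b)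
    (hb : d b = 6 * s * b - 12 * a ^ 2) : d (d (hasseInvariant p (3 * a) b)) = 0 := by
  have hn : ∀ n : ℕ, d (n : A) = 0 := fun n => d.map_natCast n
  have h2 : d 2 = 0 := by exact_mod_cast hn 2
  have h3 : d 3 = 0 := by exact_mod_cast hn 3
  have h4 : d 4 = 0 := by exact_mod_cast hn 4
  have h6 : d 6 = 0 := by exact_mod_cast hn 6
  have h12 : d 12 = 0 := by exact_mod_cast hn 12
  have ha' : d (3 * a) = 12 * s * a + 6 * b := by
    simp only [Derivation.leibniz, smul_eq_mul, h3, ha]; ring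
  have ha'' : d (12 * s * a + 6 * b) = 60 * (s ^ 2 * a - a ^ 2 + s * b) := by
    simp only [map_add, Derivation.leibniz, smul_eq_mul, h6, h12, ha, hs, hb]; ring
  have hb'' : d (6 * s * b - 12 * a ^ 2) = 42 * (s ^ 2 * b - a * b - 4 * s * a ^ 2) := by
    simp only [map_sub, Derivation.leibniz, Derivation.leibniz_pow, nsmul_eq_mul, smul_eq_mul, h6,
      h12, ha, hs, hb]
    push_cast; ring
  refine derivation_derivation_hasseInvariant d hp hodd (3 * a) b
    (C (-12 * (a ^ 2 - s * b - s ^ 2 * a)) * X ^ 2 +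
      C (-6 * a * b - 24 * s * a ^ 2 + 6 * s ^ 2 * b) * X + C (-24 * a ^ 3 - 6 * b ^ 2)) ?_
  rw [ha', ha'', hb, hb'']
  have e1 : derivative (shortCubic (3 * a) b) = 3 * X ^ 2 + C (3 * a) := by
    simp only [shortCubic, derivative_add, derivative_X_pow, derivative_C_mul, derivative_X,
      derivative_C]
    push_cast [map_ofNat]
    ring
  have e2 : ∀ u v w : A, derivative (C u * X ^ 2 + C v * X + C w) = C u * (2 * X) + C v := by
    intro u v w
    simp only [derivative_add, derivative_X_sq, derivative_C_mul, derivative_X, derivative_C,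
      map_ofNat]
    ring
  rw [e1, e2]
  simp only [shortCubic, map_mul, map_sub, map_add, map_pow, map_neg, map_ofNat]
  ring

end

section

variable {k : Type*} [Field k]

theorem hasseInvariant_cusp {p : ℕ} [hp : Fact p.Prime] [CharP k p] (h5 : 5 ≤ p) {c : k}
    (hc : c * 1728 = 1) : hasseInvariant p (-36 * c) (2 * c) = 1 := by
  open Polynomial in
  have hodd : p % 2 = 1 := hp.out.eq_two_or_odd.resolve_left (by omega)
  set n := p / 2 with hn
  have hp2 : p - 1 = 2 * n := by omega
  set e : k := 144 * c with he
  have hf : shortCubic (-36 * c) (2 * c) = (X - C e) ^ 2 * (X + C (2 * e)) := by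
    have hc' : (C c : k[X]) * 1728 = 1 := by
      rw [← map_ofNat C, ← map_mul, hc, map_one]
    simp only [shortCubic, he, map_mul, map_neg, map_ofNat]
    linear_combination (-36 * C c * X + 2 * C c + 2 * C c * (C c * 1728)) * (-hc')
  have hgeom : (X - C e) ^ (p - 1) = ∑ i ∈ Finset.range p, X ^ i * C e ^ (p - 1 - i) := by
    have h1 := (Commute.all (X : k[X]) (C e)).geom_sum₂_mul p
    have h2 : (X - C e : k[X]) ^ p = X ^ p - C e ^ p := sub_pow_char ..
    rw [← h2, show p = p - 1 + 1 by omega, pow_succ, Nat.add_sub_cancel] at h1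
    rw [← mul_right_cancel₀ (X_sub_C_ne_zero e) h1, Nat.sub_add_cancel hp.out.one_le]
  have hdeg : ((X + C (2 * e) : k[X]) ^ n).natDegree = n := by
    rw [natDegree_pow, natDegree_X_add_C, mul_one]
  rw [hasseInvariant, hf, mul_pow, ← pow_mul, ← hn, ← hp2, hgeom, Finset.sum_mul, finsetSum_coeff]
  have hcoef : ∀ i ∈ Finset.range p, ((X ^ i * C e ^ (p - 1 - i)) * (X + C (2 * e)) ^ n).coeff
      (p - 1) = ((X + C (2 * e)) ^ n).coeff (p - 1 - i) * e ^ (p - 1 - i) := by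
    intro i hi
    have := Finset.mem_range.1 hi
    rw [mul_assoc, coeff_X_pow_mul', if_pos (by omega), ← C_pow, coeff_C_mul, mul_comm]
  rw [Finset.sum_congr rfl hcoef]
  refine (Finset.sum_range_reflect (fun i => ((X + C (2 * e)) ^ n).coeff i * e ^ i) p).trans ?_
  rw [← eval_eq_sum_range' (by omega)]
  have h4 : (e + 2 * e) * 2 ^ 2 = 1 := by rw [he]; linear_combination hc
  have h2 : (2 : k) ^ (p - 1) = 1 := by
    have := ZMod.pow_card_sub_one_eq_one (p := p) (a := 2) (by
      intro h
      have := (ZMod.natCast_eq_zero_iff 2 p).1 (by exact_mod_cast h)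
      have := Nat.le_of_dvd (by norm_num) this
      omega)
    simpa only [map_pow, map_ofNat, map_one] using congrArg (ZMod.castHom dvd_rfl k) this
  have := congrArg (· ^ n) h4
  simp only [mul_pow, one_pow, ← pow_mul, ← hp2, h2, mul_one] at this
  simpa using this

/-- The Hasse invariant of the universal curve has constant `q`-expansion up to order `p`. -/
theorem coeff_hasseInvariant_eq_zero {p : ℕ} [hp : Fact p.Prime] [CharP k p] (h5 : 5 ≤ p) {c : k}
    (hc : c * 1728 = 1) {n : ℕ} (h0 : n ≠ 0) (hn : n < p) :
    PowerSeries.coeff n (hasseInvariant p (PowerSeries.C (-36 * c) * serQ k)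
      (PowerSeries.C (2 * c) * serR k)) = 0 := by
  have hodd : p % 2 = 1 := hp.out.eq_two_or_odd.resolve_left (by omega)
  have : CharP (PowerSeries k) p := charP_of_injective_algebraMap (R := k)
    (FaithfulSMul.algebraMap_injective k _) p
  have hc' : PowerSeries.C c * 1728 = 1 := by
    rw [← map_ofNat PowerSeries.C, ← map_mul, hc, map_one]
  have e3 : PowerSeries.C (-36 * c) * serQ k = 3 * (PowerSeries.C (-12 * c) * serQ k) := by
    simp only [map_mul, map_neg, map_ofNat]; ring
  have h := derivation_derivation_hasseInvariant_of_system (qDeriv k) h5 hodd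
    (s := PowerSeries.C (144 * c) * serP k) (a := PowerSeries.C (-12 * c) * serQ k)
    (b := PowerSeries.C (2 * c) * serR k) ?_ ?_ ?_
  · rw [← e3] at h
    have := congrArg (PowerSeries.coeff n) h
    rw [coeff_qDeriv, coeff_qDeriv, map_zero, mul_eq_zero, mul_eq_zero] at this
    have hn0 : (n : k) ≠ 0 := by
      rw [Ne, CharP.cast_eq_zero_iff k p]
      exact fun h => absurd (Nat.le_of_dvd (by omega) h) (by omega)
    tauto
  all_goals
    rw [← PowerSeries.smul_eq_C_mul, Derivation.map_smul]
    simp only [PowerSeries.smul_eq_C_mul, map_mul, map_neg, map_ofNat]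
  · linear_combination 12 * PowerSeries.C c * qDeriv_serP k -
      (12 * PowerSeries.C c * serP k ^ 2) * hc'
  · linear_combination (-4 * PowerSeries.C c) * qDeriv_serQ k +
      (4 * PowerSeries.C c * serP k * serQ k) * hc'
  · linear_combination PowerSeries.C c * qDeriv_serR k +
      (PowerSeries.C c * serQ k ^ 2 - PowerSeries.C c * serP k * serR k) * hc'

end

section

open UpperHalfPlane ModularForm

theorem coeff_hasseInvariant {p : ℕ} [hp : Fact p.Prime] {k : Type*} [Field k] [CharP k p]
    (h5 : 5 ≤ p) {c : k}
    (hc : c * 1728 = 1) {n : ℕ} (hn : n < p) :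
    PowerSeries.coeff n (hasseInvariant p (PowerSeries.C (-36 * c) * serQ k)
      (PowerSeries.C (2 * c) * serR k)) = if n = 0 then 1 else 0 := by
  split_ifs with h0
  · subst h0
    rw [PowerSeries.coeff_zero_eq_constantCoeff_apply, hasseInvariant_map,
      map_mul PowerSeries.constantCoeff, map_mul PowerSeries.constantCoeff,
      PowerSeries.constantCoeff_C, PowerSeries.constantCoeff_C]
    have h1 : PowerSeries.constantCoeff (serQ k) = 1 := coeff_zero_serQ k
    have h2 : PowerSeries.constantCoeff (serR k) = 1 := coeff_zero_serR k
    rw [h1, h2, mul_one, mul_one, hasseInvariant_cusp h5 hc]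
  · exact coeff_hasseInvariant_eq_zero h5 hc h0 hn

open Polynomial in
theorem coeff_shortCubic_pow_succ {A : Type*} [CommRing A] (α β : A) (n j : ℕ) :
    (shortCubic α β ^ (n + 1)).coeff j =
      (if 3 ≤ j then (shortCubic α β ^ n).coeff (j - 3) else 0) +
      (if 1 ≤ j then (shortCubic α β ^ n).coeff (j - 1) else 0) * α +
      (shortCubic α β ^ n).coeff j * β := by
  have e : shortCubic α β ^ (n + 1) = shortCubic α β ^ n * X ^ 3 +
      shortCubic α β ^ n * X ^ 1 * C α + shortCubic α β ^ n * C β := by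
    rw [pow_succ]; nth_rw 2 [shortCubic]; ring
  rw [e, coeff_add, coeff_add, coeff_mul_C, coeff_mul_C, coeff_mul_X_pow', coeff_mul_X_pow']

open Polynomial in
theorem IsIntegralForm.coeff_shortCubic_pow {R : Type*} [CommRing R] [Algebra R ℂ] {F G : ℍ → ℂ}
    {f g : PowerSeries R} (hF : IsIntegralForm R 4 F f) (hG : IsIntegralForm R 6 G g) (n j : ℕ) :
    IsIntegralForm R (6 * n - 2 * j) ((shortCubic F G ^ n).coeff j)
      ((shortCubic f g ^ n).coeff j) := by
  have hz : ∀ K, IsIntegralForm R K 0 (0 : PowerSeries R) := IsIntegralForm.zero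
  induction n generalizing j with
  | zero =>
    rw [pow_zero, pow_zero, coeff_one, coeff_one]
    split_ifs with h
    · subst h
      exact IsIntegralForm.one.congr_weight (by simp)
    · exact hz _
  | succ n ih =>
    rw [coeff_shortCubic_pow_succ, coeff_shortCubic_pow_succ]
    refine IsIntegralForm.add (IsIntegralForm.add ?_ ?_) (((ih j).mul hG).congr_weight ?_)
    · split_ifs with h
      · exact (ih _).congr_weight (by push_cast [h]; ring)
      · exact hz _
    · split_ifs with h
      · exact ((ih _).mul hF).congr_weight (by push_cast [h]; ring)
      · rw [zero_mul, zero_mul]; exact hz _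
    · push_cast; ring

theorem IsIntegralForm.hasseInvariant {R : Type*} [CommRing R] [Algebra R ℂ] {F G : ℍ → ℂ}
    {f g : PowerSeries R} (hF : IsIntegralForm R 4 F f) (hG : IsIntegralForm R 6 G g) {p : ℕ}
    (hp : p % 2 = 1) :
    IsIntegralForm R (p - 1) (hasseInvariant p F G) (hasseInvariant p f g) :=
  (hF.coeff_shortCubic_pow hG _ _).congr_weight (by omega)

end

section

open UpperHalfPlane ModularForm
open scoped MatrixGroups

section

variable (p : ℕ) [hp : Fact p.Prime]

/-- The point `p * τ` of the upper half plane. -/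
noncomputable def isogUp (τ : ℍ) : ℍ :=
  ⟨p * τ, by
    have : (0 : ℝ) < p := by exact_mod_cast hp.out.pos
    simpa using mul_pos this τ.im_pos⟩

/-- The point `(τ + n) / p` of the upper half plane. -/
noncomputable def isogDown (n : ℤ) (τ : ℍ) : ℍ :=
  ⟨(τ + n) / p, by
    have : (0 : ℝ) < p := by exact_mod_cast hp.out.pos
    rw [Complex.div_natCast_im]
    simpa using div_pos τ.im_pos this⟩

theorem coe_isogUp (τ : ℍ) : (isogUp p τ : ℂ) = p * τ := rfl

theorem coe_isogDown (n : ℤ) (τ : ℍ) : (isogDown p n τ : ℂ) = (τ + n) / p := rfl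

variable {p} {k : ℕ} (h : ModularForm 𝒮ℒ k)

theorem ModularForm.apply_eq_of_coe_eq (γ : SL(2, ℤ)) {w w' : ℍ}
    (hw : (w' : ℂ) * (γ 1 0 * w + γ 1 1) = γ 0 0 * w + γ 0 1) :
    h w' = ((γ 1 0 : ℂ) * w + γ 1 1) ^ k * h w := by
  have hd : denom γ w = (γ 1 0 : ℂ) * w + γ 1 1 := by
    simp [ModularGroup.denom_apply]
  have h0 : (γ 1 0 : ℂ) * w + γ 1 1 ≠ 0 := by rw [← hd]; exact denom_ne_zero _ _
  have e : w' = γ • w := by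
    ext
    rw [coe_specialLinearGroup_apply]
    simp only [algebraMap_int_eq, eq_intCast, Complex.ofReal_intCast]
    rw [eq_div_iff h0, hw]
  have h1 : (⇑h ∣[(k : ℤ)] γ) = h := SlashInvariantForm.slash_action_eqn h _ ⟨γ, rfl⟩
  have h2 := congrFun h1 w
  rw [SL_slash_apply, hd, zpow_neg, zpow_natCast, ← div_eq_mul_inv,
    div_eq_iff (pow_ne_zero _ h0)] at h2
  rw [e, h2, mul_comm]

theorem ModularForm.apply_of_coe_eq_add_int {w w' : ℍ} (n : ℤ) (hw : (w' : ℂ) = w + n) :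
    h w' = h w := by
  have := h.apply_eq_of_coe_eq (ModularGroup.T ^ n) (w := w) (w' := w')
    (by simp [ModularGroup.coe_T_zpow, hw])
  simpa [ModularGroup.coe_T_zpow] using this

theorem ModularForm.apply_isogDown_congr {m n : ℤ} (hmn : (m : ZMod p) = n) (τ : ℍ) :
    h (isogDown p m τ) = h (isogDown p n τ) := by
  obtain ⟨c, hc⟩ := (ZMod.intCast_eq_intCast_iff_dvd_sub n m p).1 hmn.symm
  refine h.apply_of_coe_eq_add_int c ?_
  have h0 : (p : ℂ) ≠ 0 := by exact_mod_cast hp.out.ne_zero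
  have hc' : (m : ℂ) - n = p * c := by exact_mod_cast hc
  rw [coe_isogDown, coe_isogDown]
  field_simp
  linear_combination hc'

theorem ModularForm.apply_isogDown_S {m n : ℤ} (hmn : ((m * n : ℤ) : ZMod p) = -1) (τ : ℍ) :
    h (isogDown p m (ModularGroup.S • τ)) = (τ : ℂ) ^ k * h (isogDown p n τ) := by
  obtain ⟨c, hc⟩ := (ZMod.intCast_eq_intCast_iff_dvd_sub (m * n) (-1) p).1 (by rw [hmn]; simp)
  have h0 : (p : ℂ) ≠ 0 := by exact_mod_cast hp.out.ne_zero
  have hτ := τ.ne_zero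
  have hc' : -1 - (m : ℂ) * n = p * c := by exact_mod_cast hc
  have hdet : Matrix.det !![m, c; (p : ℤ), -n] = 1 := by
    rw [Matrix.det_fin_two_of]; linear_combination hc
  rw [h.apply_eq_of_coe_eq ⟨!![m, c; (p : ℤ), -n], hdet⟩ (w := isogDown p n τ)]
  · simp only [coe_isogDown]
    congr 2
    simp
    field_simp
    ring
  · rw [modular_S_smul]
    simp only [coe_isogDown]
    simp
    field_simp
    linear_combination (τ : ℂ) * hc'

theorem ModularForm.apply_isogDown_zero_S (τ : ℍ) :
    h (isogDown p 0 (ModularGroup.S • τ)) = (p : ℂ) ^ k * (τ : ℂ) ^ k * h (isogUp p τ) := by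
  have h0 : (p : ℂ) ≠ 0 := by exact_mod_cast hp.out.ne_zero
  have hτ := τ.ne_zero
  rw [h.apply_eq_of_coe_eq ModularGroup.S (w := isogUp p τ)]
  · simp [ModularGroup.S, coe_isogUp, mul_pow]
  · rw [modular_S_smul, coe_isogDown, coe_isogUp]
    simp [ModularGroup.S]
    field_simp

theorem ModularForm.apply_isogUp_S (τ : ℍ) :
    (p : ℂ) ^ k * h (isogUp p (ModularGroup.S • τ)) = (τ : ℂ) ^ k * h (isogDown p 0 τ) := by
  have h0 : (p : ℂ) ≠ 0 := by exact_mod_cast hp.out.ne_zero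
  have hτ := τ.ne_zero
  rw [h.apply_eq_of_coe_eq ModularGroup.S (w := isogDown p 0 τ)]
  · simp [ModularGroup.S, coe_isogDown, div_pow]
    field_simp
  · rw [modular_S_smul, coe_isogDown, coe_isogUp]
    simp [ModularGroup.S]
    field_simp

theorem ModularForm.apply_S (τ : ℍ) : h (ModularGroup.S • τ) = (τ : ℂ) ^ k * h τ := by
  have hτ := τ.ne_zero
  rw [h.apply_eq_of_coe_eq ModularGroup.S (w := τ)]
  · simp [ModularGroup.S]
  · rw [modular_S_smul]
    simp [ModularGroup.S]
    field_simp

variable (p) in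
/-- The product, over the subgroups of order `p` of a lattice, of linear combinations of the value
of `g` at the lattice and the value of `h` at the quotient by the subgroup. -/
noncomputable def isogNorm (g h : ℍ → ℂ) (u v u' v' : ℂ) : ℍ → ℂ :=
  (u • g + v • (h ∘ isogUp p)) * ∏ b : ZMod p, (u' • g + v' • (h ∘ isogDown p b.val))

theorem isogNorm_apply (g h : ℍ → ℂ) (u v u' v' : ℂ) (τ : ℍ) : isogNorm p g h u v u' v' τ =
    (u * g τ + v * h (isogUp p τ)) * ∏ b : ZMod p, (u' * g τ + v' * h (isogDown p b.val τ)) := by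
  simp [isogNorm, Finset.prod_apply]

variable (g : ModularForm 𝒮ℒ k) {u v u' v' : ℂ}

theorem isogNorm_slash_T :
    isogNorm p g h u v u' v' ∣[((k * (p + 1) : ℕ) : ℤ)] ModularGroup.T = isogNorm p g h u v u' v' := by
  ext τ
  have hc : ((ModularGroup.T • τ : ℍ) : ℂ) = τ + 1 := by
    rw [modular_T_smul, coe_vadd, add_comm]; simp
  rw [SL_slash_apply, ModularGroup.denom_apply]
  have h0 : (p : ℂ) ≠ 0 := by exact_mod_cast hp.out.ne_zero
  rw [isogNorm_apply, isogNorm_apply, g.apply_of_coe_eq_add_int 1 (w := τ) (by rw [hc]; simp),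
    h.apply_of_coe_eq_add_int p (w := isogUp p τ) (by
      rw [coe_isogUp, coe_isogUp, hc]; push_cast; ring)]
  have : ∏ b : ZMod p, (u' * g τ + v' * h (isogDown p b.val (ModularGroup.T • τ))) =
      ∏ b : ZMod p, (u' * g τ + v' * h (isogDown p b.val τ)) := by
    refine Fintype.prod_equiv (Equiv.addRight 1) _ _ fun b => ?_
    congr 2
    have e : isogDown p b.val (ModularGroup.T • τ) = isogDown p (b.val + 1) τ := by
      ext
      rw [coe_isogDown, coe_isogDown, hc]
      push_cast
      ring
    rw [e]
    exact h.apply_isogDown_congr (by simp) _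
  rw [this]
  simp [ModularGroup.T]

theorem isogNorm_slash_S (huv : u * v' * p ^ k = u' * v) :
    isogNorm p g h u v u' v' ∣[((k * (p + 1) : ℕ) : ℤ)] ModularGroup.S = isogNorm p g h u v u' v' := by
  ext τ
  have hτ := τ.ne_zero
  have h0 : (p : ℂ) ≠ 0 := by exact_mod_cast hp.out.ne_zero
  rw [SL_slash_apply, ModularGroup.denom_S, zpow_neg, zpow_natCast, ← div_eq_mul_inv,
    div_eq_iff (pow_ne_zero _ hτ), isogNorm_apply, isogNorm_apply, g.apply_S,
    ← Finset.mul_prod_erase _ _ (Finset.mem_univ (0 : ZMod p)),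
    ← Finset.mul_prod_erase _ _ (Finset.mem_univ (0 : ZMod p))]
  have : ∏ b ∈ Finset.univ.erase (0 : ZMod p),
      (u' * ((τ : ℂ) ^ k * g τ) + v' * h (isogDown p b.val (ModularGroup.S • τ))) =
      ((τ : ℂ) ^ k) ^ (p - 1) *
      ∏ b ∈ Finset.univ.erase (0 : ZMod p), (u' * g τ + v' * h (isogDown p b.val τ)) := by
    have hcard : (Finset.univ.erase (0 : ZMod p)).card = p - 1 := by
      rw [Finset.card_erase_of_mem (Finset.mem_univ _), Finset.card_univ, ZMod.card]
    rw [← hcard, ← Finset.prod_const, ← Finset.prod_mul_distrib]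
    refine Finset.prod_nbij' (fun b => -b⁻¹) (fun b => -b⁻¹) (by simp) (by simp) (by simp)
      (by simp) fun b hb => ?_
    have hb0 : b ≠ 0 := by simpa using hb
    rw [h.apply_isogDown_S (n := ((-b⁻¹ : ZMod p).val : ℤ)) (by simp [hb0])]
    ring
  rw [this, show k * (p + 1) = k + k + k * (p - 1) by
    have := hp.out.pos
    obtain ⟨m, rfl⟩ : ∃ m, p = m + 1 := ⟨p - 1, by omega⟩
    simp; ring, pow_add, pow_add, ← pow_mul]
  have e1 := h.apply_isogUp_S (p := p) τ
  have e2 := h.apply_isogDown_zero_S (p := p) τ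
  simp only [ZMod.val_zero, Nat.cast_zero]
  rw [e2]
  linear_combination ((τ : ℂ) ^ (k * (p - 1)) *
    ∏ b ∈ Finset.univ.erase (0 : ZMod p), (u' * g τ + v' * h (isogDown p b.val τ))) *
    ((((τ : ℂ) ^ k) ^ 2 * g τ * h (isogUp p τ) -
      g τ * (τ : ℂ) ^ k * h (isogUp p (ModularGroup.S • τ))) * huv +
    (v * v' * (τ : ℂ) ^ k * h (isogUp p τ) + g τ * (τ : ℂ) ^ k * u * v') * e1)

end

namespace QRep

variable {p : ℕ} [hp : Fact p.Prime] {F : ℍ → ℂ} {G : PowerSeries ℂ}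

theorem comp_isogUp (h : QRep 1 F G) :
    QRep p (F ∘ isogUp p)
      (PowerSeries.expand (p * p) (mul_ne_zero hp.out.ne_zero hp.out.ne_zero) G) := fun τ => by
  have h0 : (p : ℂ) ≠ 0 := by exact_mod_cast hp.out.ne_zero
  have e : Function.Periodic.qParam 1 (isogUp p τ) = Function.Periodic.qParam p τ ^ (p * p) := by
    rw [Function.Periodic.qParam, Function.Periodic.qParam, ← Complex.exp_nat_mul, coe_isogUp]
    congr 1
    push_cast
    field_simp
  have hinj : Function.Injective fun n : ℕ => p * p * n := fun a b h =>
    Nat.eq_of_mul_eq_mul_left (Nat.mul_pos hp.out.pos hp.out.pos) h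
  have := h (isogUp p τ)
  rw [e] at this
  change HasSum _ (F (isogUp p τ))
  rw [← hinj.hasSum_iff]
  · convert this using 2 with n
    rw [Function.comp_apply, PowerSeries.coeff_expand_mul, pow_mul]
  · intro x hx
    rw [PowerSeries.coeff_expand_of_not_dvd, zero_mul]
    rintro ⟨c, rfl⟩
    exact hx ⟨c, rfl⟩

theorem comp_isogDown (h : QRep 1 F G) (b : ℕ) :
    QRep p (F ∘ isogDown p b)
      (PowerSeries.rescale (Complex.exp (2 * Real.pi * Complex.I / p) ^ b) G) := fun τ => by
  have h0 : (p : ℂ) ≠ 0 := by exact_mod_cast hp.out.ne_zero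
  have e : Function.Periodic.qParam 1 (isogDown p b τ) =
      Complex.exp (2 * Real.pi * Complex.I / p) ^ b * Function.Periodic.qParam p τ := by
    rw [Function.Periodic.qParam, Function.Periodic.qParam, ← Complex.exp_nat_mul, coe_isogDown,
      ← Complex.exp_add]
    congr 1
    push_cast
    field_simp
    ring
  change HasSum _ (F (isogDown p b τ))
  convert h (isogDown p b τ) using 2 with n
  rw [e, PowerSeries.coeff_rescale, mul_pow]
  ring

end QRep

/-- The `q`-expansion of `isogNorm`, as a series in `exp (2πiτ/p)`. -/
noncomputable def isogNormSeries {R : Type*} [CommRing R] (p : ℕ) [hp : Fact p.Prime] (ζ : R)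
    (g h : PowerSeries R) (u v u' v' : R) : PowerSeries R :=
  (PowerSeries.C u * PowerSeries.expand p hp.out.ne_zero g + PowerSeries.C v *
      PowerSeries.expand (p * p) (mul_ne_zero hp.out.ne_zero hp.out.ne_zero) h) *
    ∏ b : ZMod p, (PowerSeries.C u' * PowerSeries.expand p hp.out.ne_zero g +
      PowerSeries.C v' * PowerSeries.rescale (ζ ^ b.val) h)

theorem map_isogNormSeries {R S : Type*} [CommRing R] [CommRing S] (φ : R →+* S) (p : ℕ)
    [hp : Fact p.Prime] (ζ : R) (g h : PowerSeries R) (u v u' v' : R) :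
    PowerSeries.map φ (isogNormSeries p ζ g h u v u' v') =
      isogNormSeries p (φ ζ) (PowerSeries.map φ g) (PowerSeries.map φ h) (φ u) (φ v) (φ u')
        (φ v') := by
  simp only [isogNormSeries, map_mul, map_add, map_prod, PowerSeries.map_C,
    ← PowerSeries.map_expand, ← PowerSeries.rescale_map, map_pow]

variable {R : Type*} [CommRing R] [Algebra R ℂ] [FaithfulSMul R ℂ] {p : ℕ} [hp : Fact p.Prime]

theorem IsIntegralForm.isogNorm {k : ℕ} {F H : ℍ → ℂ} {g h : PowerSeries R}
    (hF : IsIntegralForm R k F g) (hH : IsIntegralForm R k H h) {ζ : R}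
    (hζ : algebraMap R ℂ ζ = Complex.exp (2 * Real.pi * Complex.I / p)) {u v u' v' : R}
    (huv : u * v' * p ^ k = u' * v) :
    ∃ s, IsIntegralForm R (k * (p + 1)) (isogNorm p F H (algebraMap R ℂ u) (algebraMap R ℂ v)
      (algebraMap R ℂ u') (algebraMap R ℂ v')) s ∧
      PowerSeries.expand p hp.out.ne_zero s = isogNormSeries p ζ g h u v u' v' := by
  set P := isogNormSeries p ζ g h u v u' v' with hP
  set Φ := _root_.isogNorm p F H (algebraMap R ℂ u) (algebraMap R ℂ v)
      (algebraMap R ℂ u') (algebraMap R ℂ v') with hΦ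
  have hp0 : (0 : ℝ) < p := by exact_mod_cast hp.out.pos
  have e1 : (p : ℝ) * 1 = p := mul_one _
  have hQ : QRep p Φ (PowerSeries.map (algebraMap R ℂ) P) := by
    rw [hP, map_isogNormSeries, hζ]
    have h1 := hF.2.expand p hp.out.ne_zero
    rw [e1] at h1
    have key : ∀ (c d : ℂ) {F' G'}, QRep p F' G' → QRep p (c • F + d • F')
        (PowerSeries.C c * PowerSeries.expand p hp.out.ne_zero
          (PowerSeries.map (algebraMap R ℂ) g) + PowerSeries.C d * G') := by
      intro c d F' G' h'
      rw [← PowerSeries.smul_eq_C_mul, ← PowerSeries.smul_eq_C_mul]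
      exact (h1.smul c).add (h'.smul d)
    refine (key _ _ hH.2.comp_isogUp).mul (QRep.prod _ fun b _ => key _ _ ?_)
    exact hH.2.comp_isogDown b.val
  obtain ⟨⟨f, rfl⟩, -⟩ := hF
  obtain ⟨⟨h', rfl⟩, -⟩ := hH
  have huv' : algebraMap R ℂ u * algebraMap R ℂ v' * p ^ k = algebraMap R ℂ u' * algebraMap R ℂ v := by
    rw [← map_mul, ← map_mul, ← huv]; simp
  obtain ⟨Ψ, hΨ⟩ := hQ.exists_modularForm hp0 (isogNorm_slash_S h' f huv') (isogNorm_slash_T h' f)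
  have h2 := (QRep.modularForm Ψ).expand p hp.out.ne_zero
  rw [e1, hΨ] at h2
  rw [← hΨ] at h2 hQ
  have h3 := QRep.unique Ψ hp.out.pos h2 hQ
  have hinj := FaithfulSMul.algebraMap_injective R ℂ
  have h4 : PowerSeries.expand p hp.out.ne_zero (PowerSeries.mk fun n => PowerSeries.coeff (p * n) P)
      = P := by
    ext n
    by_cases hn : p ∣ n
    · obtain ⟨m, rfl⟩ := hn
      rw [PowerSeries.coeff_expand_mul, PowerSeries.coeff_mk]
    · rw [PowerSeries.coeff_expand_of_not_dvd _ _ _ hn]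
      apply hinj
      rw [map_zero, ← PowerSeries.coeff_map, ← h3, PowerSeries.coeff_expand_of_not_dvd _ _ _ hn]
  refine ⟨.mk fun n => PowerSeries.coeff (p * n) P, ⟨⟨Ψ.mcast (by push_cast; rfl), hΨ⟩, ?_⟩, h4⟩
  rw [← hΨ]
  convert QRep.modularForm Ψ using 1
  ext n
  rw [PowerSeries.coeff_map, PowerSeries.coeff_mk, ← PowerSeries.coeff_map, ← h3,
    PowerSeries.coeff_expand_mul]

end

section

open UpperHalfPlane ModularForm
open scoped MatrixGroups

theorem PowerSeries.expand_injective {R : Type*} [CommRing R] (p : ℕ) (hp : p ≠ 0) :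
    Function.Injective (PowerSeries.expand (R := R) p hp) := fun f g h => by
  ext n
  rw [← PowerSeries.coeff_expand_mul p hp, h, PowerSeries.coeff_expand_mul]

theorem PowerSeries.expand_map_frobenius {R : Type*} [CommRing R] (p : ℕ) [hp : Fact p.Prime]
    [CharP R p] (f : PowerSeries R) :
    PowerSeries.expand p hp.out.ne_zero (PowerSeries.map (frobenius R p) f) = f ^ p := by
  rw [← PowerSeries.map_expand]
  exact MvPowerSeries.map_frobenius_expand p hp.out.ne_zero

theorem eq_of_expand_eq_isogNormSeries {K : Type*} [CommRing K] {p : ℕ} [hp : Fact p.Prime]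
    [CharP K p] {s g h : PowerSeries K} {u v u' v' : K}
    (hs : PowerSeries.expand p hp.out.ne_zero s = isogNormSeries p 1 g h u v u' v') :
    s = (PowerSeries.C u * g + PowerSeries.C v * PowerSeries.expand p hp.out.ne_zero h) *
      (PowerSeries.C (u' ^ p) * g ^ p +
        PowerSeries.C (v' ^ p) * PowerSeries.map (frobenius K p) h) := by
  apply PowerSeries.expand_injective p hp.out.ne_zero
  have : CharP (PowerSeries K) p := charP_of_injective_ringHom PowerSeries.C_injective p
  rw [hs, isogNormSeries]
  simp only [one_pow, PowerSeries.rescale_one, RingHom.id_apply, Finset.prod_const,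
    Finset.card_univ, ZMod.card, map_mul, map_add, map_pow, PowerSeries.expand_C,
    PowerSeries.expand_map_frobenius, ← PowerSeries.expand_mul]
  rw [add_pow_char, mul_pow, mul_pow]

theorem hasseInvariant_mul_pow {A : Type*} [CommRing A] [IsDomain A] {p : ℕ} (hp : p % 2 = 1)
    {u : A} (hu : u ≠ 0) (α β : A) :
    hasseInvariant p (u ^ 4 * α) (u ^ 6 * β) = u ^ (p - 1) * hasseInvariant p α β := by
  open Polynomial in
  have e : (shortCubic (u ^ 4 * α) (u ^ 6 * β)).comp (C (u ^ 2) * X) =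
      C (u ^ 6) * shortCubic α β := by
    simp [shortCubic]
    ring
  have h := congrArg (fun f : A[X] => (f ^ (p / 2)).coeff (p - 1)) e
  simp only [mul_pow, ← pow_comp, comp_C_mul_X_coeff, ← C_pow, coeff_C_mul] at h
  have h2 : u ^ (2 * (p - 1)) ≠ 0 := pow_ne_zero _ hu
  apply mul_right_cancel₀ h2
  rw [hasseInvariant, hasseInvariant, pow_mul, h, ← pow_mul, mul_right_comm, ← pow_mul, ← pow_add]
  congr 2
  omega

variable {R : Type*} [CommRing R] [Algebra R ℂ] [FaithfulSMul R ℂ] {p : ℕ} [hp : Fact p.Prime]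

/-- Reduction of the relation between a modular form, its image under an isogeny of degree `p`
and the Hasse invariant. -/
theorem IsIntegralForm.frobenius_relation (h5 : 5 ≤ p) {c : R} (hc : c * 1728 = 1)
    {l : ℂ} (hl : l ≠ 0) {τ : ℍ} {A B α π π' ζ : R} (hA : algebraMap R ℂ A = l ^ 4 * E₄ τ)
    (hB : algebraMap R ℂ B = l ^ 6 * E₆ τ) {K : Type*} [Field K] [CharP K p] (φ : R →+* K)
    (hζ : algebraMap R ℂ ζ = Complex.exp (2 * Real.pi * Complex.I / p)) (hφζ : φ ζ = 1)
    (hπ : π * π' = p) (hφπ : φ π = 0) {k : ℕ} (hk : 0 < k) (hk6 : k ≤ 6) {F : ℍ → ℂ}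
    {f : PowerSeries R}
    (hF : IsIntegralForm R k F f)
    (hf : PowerSeries.map (frobenius K p) (PowerSeries.map φ f) = PowerSeries.map φ f)
    (hα : algebraMap R ℂ α = l ^ k * F τ)
    (h0 : F (isogDown p 0 τ) = algebraMap R ℂ π' ^ k * F τ) :
    φ α * (φ π' ^ (k * p) * φ α ^ p -
      φ α * _root_.hasseInvariant p (-36 * φ c * φ A) (2 * φ c * φ B) ^ k) = 0 := by
  have hodd : p % 2 = 1 := hp.out.eq_two_or_odd.resolve_left (by omega)
  obtain ⟨s, hs, hse⟩ := hF.isogNorm hF hζ (u := 1) (v := -π ^ k) (u' := π' ^ k) (v' := -1)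
    (by rw [← hπ, mul_pow]; ring)
  have hsφ : PowerSeries.map φ s = PowerSeries.map φ f *
      (PowerSeries.C ((φ π' ^ k) ^ p) * PowerSeries.map φ f ^ p - PowerSeries.map φ f) := by
    have := congrArg (PowerSeries.map φ) hse
    rw [PowerSeries.map_expand, map_isogNormSeries, hφζ] at this
    rw [eq_of_expand_eq_isogNormSeries this, hf]
    simp only [map_one, map_neg, map_pow, hφπ, zero_pow hk.ne', neg_zero, map_zero, zero_mul,
      add_zero, one_mul, (Nat.odd_iff.2 hodd).neg_one_pow, neg_mul, sub_eq_add_neg]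
  have hh := IsIntegralForm.hasseInvariant ((isIntegralForm_E₄ (R := R)).smul (-36 * c))
    ((isIntegralForm_E₆ (R := R)).smul (2 * c)) hodd
  set H := _root_.hasseInvariant p (PowerSeries.C (-36 * c) * serQ R) (PowerSeries.C (2 * c) * serR R)
    with hH
  have hD := hs.sub ((hF.mul (((hF.pow p).smul (π' ^ (k * p))).sub
    ((hF.mul (hh.pow k)).congr_weight (K' := p * k) (by ring)))).congr_weight
      (K' := k * (p + 1)) (by ring))
  have hcK : φ c * 1728 = 1 := by
    simpa only [map_mul, map_ofNat, map_one] using congrArg φ hc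
  have hHφ : PowerSeries.X ^ p ∣ PowerSeries.map φ H - 1 := by
    rw [hH, hasseInvariant_map, PowerSeries.X_pow_dvd_iff]
    intro n hn
    have := coeff_hasseInvariant h5 hcK hn
    simp only [map_mul, map_neg, map_ofNat, PowerSeries.map_C, map_serQ, map_serR] at this ⊢
    rw [map_sub, this, PowerSeries.coeff_one, sub_self]
  have hI : ∀ n < p, PowerSeries.coeff n (s - f * (PowerSeries.C (π' ^ (k * p)) * f ^ p - f * H ^ k))
      ∈ RingHom.ker φ := by
    intro n hn
    rw [RingHom.mem_ker, ← PowerSeries.coeff_map]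
    refine (PowerSeries.X_pow_dvd_iff.1 ?_) n hn
    have e : PowerSeries.map φ (s - f * (PowerSeries.C (π' ^ (k * p)) * f ^ p - f * H ^ k)) =
        PowerSeries.map φ f ^ 2 * (PowerSeries.map φ H ^ k - 1) := by
      simp only [map_sub, map_mul, map_pow, hsφ, PowerSeries.map_C, pow_mul]
      ring
    rw [e]
    refine Dvd.dvd.mul_left (hHφ.trans ?_) _
    simpa using sub_dvd_pow_sub_pow (PowerSeries.map φ H) 1 k
  obtain ⟨v, hv, hve⟩ := hD.exists_mem_eq hc hl hA hB _ (s := p) (by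
    have : (k : ℤ) * (p + 1) ≤ 6 * (p + 1) := by gcongr; exact_mod_cast hk6
    have : (5 : ℤ) ≤ p := by exact_mod_cast h5
    omega) hI
  have hR0 : _root_.isogNorm p F F (algebraMap R ℂ 1) (algebraMap R ℂ (-π ^ k)) (algebraMap R ℂ (π' ^ k))
      (algebraMap R ℂ (-1)) τ = 0 := by
    rw [isogNorm_apply]
    refine mul_eq_zero_of_right _ (Finset.prod_eq_zero (Finset.mem_univ 0) ?_)
    rw [ZMod.val_zero, Nat.cast_zero, h0]
    simp
  have hev : _root_.hasseInvariant p (algebraMap R ℂ (-36 * c) • ⇑E₄) (algebraMap R ℂ (2 * c) • ⇑E₆) τ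
      = _root_.hasseInvariant p (algebraMap R ℂ (-36 * c) * E₄ τ) (algebraMap R ℂ (2 * c) * E₆ τ) :=
    hasseInvariant_map (Pi.evalRingHom (fun _ : ℍ => ℂ) τ) p _ _
  have hval : v = -(α * (π' ^ (k * p) * α ^ p -
      α * _root_.hasseInvariant p (-36 * c * A) (2 * c * B) ^ k)) := by
    apply FaithfulSMul.algebraMap_injective R ℂ
    have e1 : l ^ ((k : ℤ) * (p + 1)) = l ^ k * l ^ k * (l ^ (p - 1)) ^ k := by
      rw [show (k : ℤ) * (p + 1) = ((k * (p + 1) : ℕ) : ℤ) by push_cast; ring, zpow_natCast,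
        ← pow_mul, ← pow_add, ← pow_add]
      congr 1
      obtain ⟨m, hm⟩ : ∃ m, p = m + 1 := ⟨p - 1, by omega⟩
      rw [hm, Nat.add_sub_cancel]
      ring
    have e2 : l ^ k * l ^ k * (l ^ (p - 1)) ^ k = l ^ k * (l ^ k) ^ p := by
      obtain ⟨m, hm⟩ : ∃ m, p = m + 1 := ⟨p - 1, by omega⟩
      rw [hm, Nat.add_sub_cancel]
      ring
    have e3 : _root_.hasseInvariant p (algebraMap R ℂ (-36 * c) * algebraMap R ℂ A)
        (algebraMap R ℂ (2 * c) * algebraMap R ℂ B) = l ^ (p - 1) * _root_.hasseInvariant p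
        (algebraMap R ℂ (-36 * c) * E₄ τ) (algebraMap R ℂ (2 * c) * E₆ τ) := by
      rw [hA, hB, mul_left_comm, mul_left_comm _ (l ^ 6), hasseInvariant_mul_pow hodd hl]
    have e4 : algebraMap R ℂ (α * (π' ^ (k * p) * α ^ p - α * _root_.hasseInvariant p (-36 * c * A)
        (2 * c * B) ^ k)) = l ^ k * F τ * (algebraMap R ℂ (π' ^ (k * p)) * (l ^ k * F τ) ^ p -
        l ^ k * F τ * (l ^ (p - 1) * _root_.hasseInvariant p
        (algebraMap R ℂ (-36 * c) * E₄ τ) (algebraMap R ℂ (2 * c) * E₆ τ)) ^ k) := by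
      rw [← e3, ← hα, ← map_mul, ← map_mul, ← hasseInvariant_map]
      simp only [map_mul, map_sub, map_pow]
    have e5 : (F * (algebraMap R ℂ (π' ^ (k * p)) • F ^ p - F * _root_.hasseInvariant p
        (algebraMap R ℂ (-36 * c) • ⇑E₄) (algebraMap R ℂ (2 * c) • ⇑E₆) ^ k)) τ =
        F τ * (algebraMap R ℂ (π' ^ (k * p)) * F τ ^ p - F τ * _root_.hasseInvariant p
        (algebraMap R ℂ (-36 * c) * E₄ τ) (algebraMap R ℂ (2 * c) * E₆ τ) ^ k) := by
      rw [← hev]; rfl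
    rw [hve, e1, Pi.sub_apply, hR0, map_neg, e4, e5]
    linear_combination (-F τ ^ (p + 1) * algebraMap R ℂ (π' ^ (k * p))) * e2
  rw [RingHom.mem_ker, hval, map_neg, neg_eq_zero] at hv
  simpa only [map_mul, map_sub, map_pow, map_neg, map_ofNat, hasseInvariant_map] using hv

end

section

open UpperHalfPlane ModularForm
open scoped MatrixGroups

variable {R : Type*} [CommRing R] [Algebra R ℂ] [FaithfulSMul R ℂ] {p : ℕ} [hp : Fact p.Prime]

/-- The mod `p` reduction of the Kronecker congruence at a point fixed by an isogeny. -/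
theorem pow_eq_self_of_isogDown {c : R} (hc : c * 1728 = 1)
    {l : ℂ} {τ : ℍ} {A B ζ : R} (hA : algebraMap R ℂ A = l ^ 4 * E₄ τ)
    (hB : algebraMap R ℂ B = l ^ 6 * E₆ τ) (hD : l ^ 12 * discriminant τ = 1)
    {K : Type*} [Field K] [CharP K p] (φ : R →+* K)
    (hζ : algebraMap R ℂ ζ = Complex.exp (2 * Real.pi * Complex.I / p)) (hφζ : φ ζ = 1)
    {t : ℂ} (hτ : ∀ h : ModularForm 𝒮ℒ 12, h (isogDown p 0 τ) = t * h τ) :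
    (φ A ^ 3) ^ p = φ A ^ 3 := by
  have hl : l ≠ 0 := by rintro rfl; simp at hD
  have hΔ := isIntegralForm_discriminant (R := R) hc
  have hE := ((isIntegralForm_E₄ (R := R)).pow 3).congr_weight (K' := 12) (by norm_num)
  have hψ := (hΔ.smul (A ^ 3)).sub hE
  set ψ : ℍ → ℂ := algebraMap R ℂ (A ^ 3) • discriminant - ⇑E₄ ^ 3 with hψdef
  have hψ0 : ψ τ = 0 := by
    simp only [hψdef, Pi.sub_apply, Pi.smul_apply, Pi.pow_apply, map_pow, hA, smul_eq_mul]
    linear_combination E₄ τ ^ 3 * hD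
  have hψ1 : ψ (isogDown p 0 τ) = 0 := by
    obtain ⟨h, hh⟩ := hψ.1
    rw [← hh, hτ, hh, hψ0, mul_zero]
  obtain ⟨s, hs, hse⟩ := IsIntegralForm.isogNorm (k := 12) (p := p) (IsIntegralForm.zero 12)
    hψ hζ (u := 0) (v := 1) (u' := 0) (v' := 1) (by simp)
  have hfc : frobenius K p (φ c) = φ c := by
    have hcK : φ c * 1728 = 1 := by
      simpa only [map_mul, map_ofNat, map_one] using congrArg φ hc
    have h2 := congrArg (frobenius K p) hcK
    rw [map_mul, map_ofNat, map_one] at h2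
    calc _ = frobenius K p (φ c) * (φ c * 1728) := by rw [hcK, mul_one]
      _ = φ c := by linear_combination φ c * h2
  have key : ∀ f : PowerSeries K, PowerSeries.map (frobenius K p) f = f →
      PowerSeries.expand p hp.out.ne_zero f = f ^ p := fun f hf => by
    conv_lhs => rw [← hf]
    exact PowerSeries.expand_map_frobenius p f
  have hsφ : PowerSeries.map φ s =
      (PowerSeries.C (φ A ^ 3) * serΔ (φ c) ^ p - (serQ K ^ 3) ^ p) *
      (PowerSeries.C ((φ A ^ 3) ^ p) * serΔ (φ c) - serQ K ^ 3) := by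
    have := congrArg (PowerSeries.map φ) hse
    rw [PowerSeries.map_expand, map_isogNormSeries, hφζ] at this
    rw [eq_of_expand_eq_isogNormSeries this]
    simp only [map_one, map_zero, zero_pow hp.out.ne_zero, zero_mul, zero_add, one_pow, one_mul,
      map_sub, map_mul, map_serΔ, map_pow, map_serQ, PowerSeries.map_C, PowerSeries.expand_C, hfc,
      key _ (map_serQ K (frobenius K p)), key _ ((map_serΔ K (frobenius K p) (φ c)).trans (by rw [hfc])),
      frobenius_def]
    ring
  have hG := ((((hΔ.pow p).smul (A ^ 3)).sub ((hE.pow p))).mul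
    ((hΔ.smul ((A ^ 3) ^ p)).sub hE)).congr_weight (K' := (12 : ℕ) * (p + 1)) (by push_cast; ring)
  obtain ⟨v, hv, hve⟩ := (hs.sub hG).exists_mem_eq hc hl hA hB (RingHom.ker φ) (s := p + 2)
    (by push_cast; omega) (fun n _ => by
      rw [RingHom.mem_ker, ← PowerSeries.coeff_map, map_sub, hsφ]
      simp only [map_sub, map_mul, map_pow, PowerSeries.map_C, map_serQ, map_serΔ]
      simp)
  have hR0 : isogNorm p 0 ψ (algebraMap R ℂ 0) (algebraMap R ℂ 1) (algebraMap R ℂ 0)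
      (algebraMap R ℂ 1) τ = 0 := by
    rw [isogNorm_apply]
    refine mul_eq_zero_of_right _ (Finset.prod_eq_zero (Finset.mem_univ 0) ?_)
    rw [ZMod.val_zero, Nat.cast_zero, hψ1]
    simp
  have hval : v = ((A ^ 3) ^ p - A ^ 3) ^ 2 := by
    apply FaithfulSMul.algebraMap_injective R ℂ
    have e1 : l ^ (((12 : ℕ) : ℤ) * (p + 1)) = (l ^ 12) ^ p * l ^ 12 := by
      rw [show (((12 : ℕ) : ℤ) * (p + 1)) = ((12 * (p + 1) : ℕ) : ℤ) by push_cast; ring,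
        zpow_natCast]
      ring
    have hA3 : algebraMap R ℂ (A ^ 3) = l ^ 12 * E₄ τ ^ 3 := by rw [map_pow, hA]; ring
    have e2 : (l ^ 12) ^ p * discriminant τ ^ p = 1 := by rw [← mul_pow, hD, one_pow]
    rw [hve, e1, Pi.sub_apply, hR0]
    simp only [Pi.mul_apply, Pi.sub_apply, Pi.smul_apply, Pi.pow_apply, smul_eq_mul]
    have e3 : (algebraMap R ℂ) ((A ^ 3) ^ p) = (l ^ 12) ^ p * (E₄ τ ^ 3) ^ p := by
      rw [map_pow, hA3, mul_pow]
    rw [map_pow _ (_ - _), map_sub, e3, hA3]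
    generalize (l ^ 12) ^ p = P at e2 ⊢
    generalize (E₄ τ ^ 3) ^ p = G
    generalize E₄ τ ^ 3 = E
    generalize discriminant τ ^ p = d at e2 ⊢
    generalize discriminant τ = D₀ at hD ⊢
    generalize l ^ 12 = L at hD ⊢
    linear_combination -(L * E - P * G) * P * G * hD +
      (L * E * (L * E - P * G) - L * E * P * G * (L * D₀ - 1)) * e2
  rw [RingHom.mem_ker, hval, map_pow, map_sub, map_pow, map_pow] at hv
  exact sub_eq_zero.1 (pow_eq_zero_iff two_ne_zero |>.1 hv)

end

section

open UpperHalfPlane ModularForm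
open scoped MatrixGroups

variable {R : Type*} [CommRing R] {p : ℕ} [hp : Fact p.Prime]

theorem exists_eq_X_sq_mul_of_expand_eq {c : R} (hc : c * 1728 = 1) {s : PowerSeries R} {ζ v u' : R}
    (hs : PowerSeries.expand p hp.out.ne_zero s =
      isogNormSeries p ζ (serΔ c) (serΔ c) 1 v u' (-1)) :
    ∃ s', s = PowerSeries.X ^ 2 * s' ∧
      PowerSeries.constantCoeff s' = ∏ b : ZMod p, -ζ ^ b.val := by
  obtain ⟨ε, hε, hε1⟩ := exists_serΔ_eq hc
  have h2 := hp.out.two_le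
  obtain ⟨m, hm⟩ : ∃ m, p = m + 2 := ⟨p - 2, by omega⟩
  have x1 : (PowerSeries.X : PowerSeries R) ^ p = PowerSeries.X * PowerSeries.X ^ (m + 1) := by
    rw [← pow_succ', hm]
  have x2 : (PowerSeries.X : PowerSeries R) ^ (p * p) =
      PowerSeries.X ^ p * PowerSeries.X ^ (p * (m + 1)) := by
    rw [← pow_add]
    congr 1
    conv_lhs => enter [2]; rw [hm]
    ring
  have x3 : ∀ a : R, PowerSeries.constantCoeff (PowerSeries.rescale a ε) = 1 := fun a => by
    rw [← PowerSeries.coeff_zero_eq_constantCoeff_apply, PowerSeries.coeff_rescale, pow_zero,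
      one_mul, PowerSeries.coeff_zero_eq_constantCoeff_apply, hε1]
  have key : ∃ Q : PowerSeries R, isogNormSeries p ζ (serΔ c) (serΔ c) 1 v u' (-1) =
      PowerSeries.X ^ (p * 2) * Q ∧ PowerSeries.constantCoeff Q = ∏ b : ZMod p, -ζ ^ b.val := by
    refine ⟨(PowerSeries.expand p hp.out.ne_zero ε + PowerSeries.C v * PowerSeries.X ^ (p * (m + 1)) *
        PowerSeries.expand (p * p) (mul_ne_zero hp.out.ne_zero hp.out.ne_zero) ε) *
      ∏ b : ZMod p, (PowerSeries.C u' * PowerSeries.X ^ (m + 1) *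
        PowerSeries.expand p hp.out.ne_zero ε -
        PowerSeries.C (ζ ^ b.val) * PowerSeries.rescale (ζ ^ b.val) ε), ?_, ?_⟩
    · have e : (PowerSeries.X : PowerSeries R) ^ p = ∏ b : ZMod p, PowerSeries.X := by
        rw [Finset.prod_const, Finset.card_univ, ZMod.card]
      have e1 : (PowerSeries.X : PowerSeries R) ^ (p * 2) = PowerSeries.X ^ p * PowerSeries.X ^ p := by
        rw [mul_two, pow_add]
      rw [e1]
      conv_rhs => rw [mul_mul_mul_comm]; enter [2, 1]; rw [e]
      rw [← Finset.prod_mul_distrib, isogNormSeries, hε]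
      congr 1
      · simp only [map_mul, map_one, PowerSeries.expand_X]
        rw [x2]
        ring
      · refine Finset.prod_congr rfl fun b _ => ?_
        simp only [map_mul, map_neg, map_one, PowerSeries.expand_X, PowerSeries.rescale_X]
        rw [x1]
        ring
    · simp [hε1, x3, map_prod, PowerSeries.constantCoeff_expand, hp.out.ne_zero]
  obtain ⟨Q, hQ, hQ1⟩ := key
  rw [hQ] at hs
  have h0 : PowerSeries.X ^ 2 ∣ s := PowerSeries.X_pow_dvd_iff.2 fun n hn => by
    rw [← PowerSeries.coeff_expand_mul p hp.out.ne_zero, hs, PowerSeries.coeff_X_pow_mul',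
      if_neg (by nlinarith)]
  obtain ⟨s', rfl⟩ := h0
  refine ⟨s', rfl, ?_⟩
  have h3 := PowerSeries.coeff_expand_mul p hp.out.ne_zero (PowerSeries.X ^ 2 * s') 2
  rw [hs, PowerSeries.coeff_X_pow_mul', PowerSeries.coeff_X_pow_mul', if_pos le_rfl, if_pos le_rfl,
    Nat.sub_self, Nat.sub_self, PowerSeries.coeff_zero_eq_constantCoeff] at h3
  rw [← h3, hQ1]

variable [Algebra R ℂ] [FaithfulSMul R ℂ]

set_option maxHeartbeats 1000000 in
/-- Integrality of the `j`-invariant at a point fixed by an isogeny. -/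
theorem map_discriminant_ne_zero_of_isogDown {c : R} (hc : c * 1728 = 1)
    {l : ℂ} (hl : l ≠ 0) {τ : ℍ} {B D ζ π π' : R} (hA : l ^ 4 * E₄ τ = 1)
    (hB : algebraMap R ℂ B = l ^ 6 * E₆ τ) (hD : algebraMap R ℂ D = l ^ 12 * discriminant τ)
    {K : Type*} [Field K] (φ : R →+* K)
    (hζ : algebraMap R ℂ ζ = Complex.exp (2 * Real.pi * Complex.I / p)) (hφζ : φ ζ = 1)
    (hπ : π * π' = p)
    (h0 : discriminant (isogDown p 0 τ) = algebraMap R ℂ π' ^ 12 * discriminant τ) :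
    φ D ≠ 0 := by
  intro hφD
  have hΔ := isIntegralForm_discriminant (R := R) hc
  obtain ⟨ε, hε, hε1⟩ := exists_serΔ_eq hc
  obtain ⟨s, hs, hse⟩ := IsIntegralForm.isogNorm (k := 12) (p := p) hΔ
    hΔ hζ (u := 1) (v := -π ^ 12) (u' := π' ^ 12) (v' := -1) (by rw [← hπ]; ring)
  obtain ⟨s', rfl, hs'⟩ := exists_eq_X_sq_mul_of_expand_eq hc hse
  set w := PowerSeries.constantCoeff s' with hw
  obtain ⟨F₁, g₁, hF₁, eF₁, eg₁⟩ := hs.exists_eq_discriminant_mul hc (by simp)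
  have eg₁' : PowerSeries.X * s' = ε * g₁ := by
    apply PowerSeries.X_mul_cancel
    rw [← mul_assoc, ← mul_assoc, ← pow_two, ← hε, eg₁]
  obtain ⟨F₂, g₂, hF₂, eF₂, eg₂⟩ := hF₁.exists_eq_discriminant_mul hc (by
    simpa [hε1] using (congrArg PowerSeries.constantCoeff eg₁').symm)
  have eg₂' : s' = ε * ε * g₂ := by
    apply PowerSeries.X_mul_cancel
    rw [eg₁', eg₂, hε]
    ring
  have hg₂ : PowerSeries.constantCoeff g₂ = w := by
    rw [hw, eg₂']
    simp [hε1]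
  have h2 := hp.out.two_le
  have hE := (((isIntegralForm_E₄ (R := R)).pow (3 * (p - 1))).congr_weight
    (K' := (12 : ℕ) * (p + 1) - 12 - 12) (by push_cast [Nat.cast_sub hp.out.one_le]; ring)).smul w
  obtain ⟨F₃, g₃, hF₃, eF₃, eg₃⟩ := (hF₂.sub hE).exists_eq_discriminant_mul hc (by
    simp [hg₂, coeff_zero_serQ])
  obtain ⟨r, -, hr⟩ := hF₃.exists_mem_eq hc hl (A := 1) (B := B) (by rw [map_one, hA]) hB ⊤
    (s := p + 1) (by push_cast; omega) (fun _ _ => trivial)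
  have hd := discriminant_ne_zero τ
  have hF₂0 : F₂ τ = 0 := by
    have : discriminant τ * (discriminant τ * F₂ τ) = 0 := by
      have e := congrFun eF₁ τ
      rw [eF₂] at e
      simp only [Pi.mul_apply] at e
      rw [← e, isogNorm_apply]
      refine mul_eq_zero_of_right _ (Finset.prod_eq_zero (Finset.mem_univ 0) ?_)
      rw [ZMod.val_zero, Nat.cast_zero, h0]
      simp
    simpa [hd] using this
  have hrel : w + D * r = 0 := by
    apply FaithfulSMul.algebraMap_injective R ℂ
    have e := congrFun eF₃ τ
    simp only [Pi.mul_apply, Pi.sub_apply, Pi.smul_apply, Pi.pow_apply, hF₂0, smul_eq_mul] at e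
    have hz : l ^ (12 : ℤ) = l ^ 12 := zpow_ofNat l 12
    have e1 : l ^ (((12 : ℕ) : ℤ) * (p + 1) - 12 - 12 - 12) * l ^ 12 = (l ^ 4) ^ (3 * (p - 1)) := by
      have hn : ((3 * (p - 1) : ℕ) : ℤ) = 3 * ((p : ℤ) - 1) := by
        rw [Nat.cast_mul, Nat.cast_sub hp.out.one_le]
        rfl
      rw [← zpow_natCast (l ^ 4), ← hz, ← zpow_add₀ hl, ← zpow_natCast l 4, ← zpow_mul, hn]
      congr 1
      push_cast
      ring
    have e2 : (l ^ 4) ^ (3 * (p - 1)) * E₄ τ ^ (3 * (p - 1)) = 1 := by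
      rw [← mul_pow, hA, one_pow]
    rw [map_add, map_mul, hr, hD, map_zero]
    rw [← e1] at e2
    generalize l ^ (((12 : ℕ) : ℤ) * (p + 1) - 12 - 12 - 12) = P at e2 ⊢
    generalize E₄ τ ^ (3 * (p - 1)) = E at e e2
    generalize F₃ τ = f at e ⊢
    generalize algebraMap R ℂ w = w' at e ⊢
    linear_combination (-P * l ^ 12) * e - w' * e2
  have := congrArg φ hrel
  rw [map_add, map_mul, hφD, zero_mul, add_zero, hs', map_zero, map_prod] at this
  simp [hφζ] at this

end

/-- Rescaling a short Weierstrass curve so that it is defined over the prime field and its Hasse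
invariant is prescribed. -/
theorem exists_zmod_hasseInvariant_eq {p : ℕ} [hp : Fact p.Prime] (hodd : p % 2 = 1) {K : Type*}
    [Field K] [CharP K p] [IsAlgClosed K] (a : ℤ) {c x y h : K} (hc : c * 1728 = 1)
    (hxy : x ^ 3 - y ^ 2 = 1728) (hh : hasseInvariant p (-36 * c * x) (2 * c * y) = h)
    (hx : x * ((a : K) ^ (4 * p) * x ^ p - x * h ^ 4) = 0)
    (hy : y * ((a : K) ^ (6 * p) * y ^ p - y * h ^ 6) = 0)
    (hj : (x ^ 3) ^ p = x ^ 3) :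
    ∃ α β : ZMod p, 4 * α ^ 3 + 27 * β ^ 2 ≠ 0 ∧ hasseInvariant p α β = a := by
  have h1728 : (1728 : K) ≠ 0 := right_ne_zero_of_mul_eq_one hc
  have hc0 : c ≠ 0 := left_ne_zero_of_mul_eq_one hc
  have hp0 := hp.out.ne_zero
  have hp1 : p - 1 ≠ 0 := by have := hp.out.two_le; omega
  have hpp : p - 1 + 1 = p := Nat.sub_add_cancel hp.out.one_le
  have hap : (a : K) ^ p = a := by
    have := map_intCast (frobenius K p) a
    rwa [frobenius_def] at this
  have hxy0 : x ≠ 0 ∨ y ≠ 0 := by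
    by_contra! hcon
    rw [hcon.1, hcon.2] at hxy
    apply h1728
    rw [← hxy]
    ring
  have hkey : ∃ u : K, u ≠ 0 ∧ (u ^ 4 * x) ^ p = u ^ 4 * x ∧ (u ^ 6 * y) ^ p = u ^ 6 * y ∧
      u ^ (p - 1) * h = a := by
    by_cases ha : (a : K) = 0
    · have hh0 : h = 0 := by
        rw [ha, zero_pow (by omega), zero_mul, zero_sub] at hx hy
        rcases hxy0 with h0 | h0
        · simpa [h0] using hx
        · simpa [h0] using hy
      simp only [hh0, ha, mul_zero, and_true]
      by_cases hx0 : x = 0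
      · have hy0 : y ≠ 0 := hxy0.resolve_left (not_not.2 hx0)
        obtain ⟨u, hu⟩ := IsAlgClosed.exists_pow_nat_eq y⁻¹ (n := 6) (by norm_num)
        refine ⟨u, ?_, ?_, ?_⟩
        · rintro rfl
          exact inv_ne_zero hy0 (by rw [← hu]; ring)
        · simp [hx0, hp0]
        · rw [hu, inv_mul_cancel₀ hy0, one_pow]
      by_cases hy0 : y = 0
      · obtain ⟨u, hu⟩ := IsAlgClosed.exists_pow_nat_eq x⁻¹ (n := 4) (by norm_num)
        refine ⟨u, ?_, ?_, ?_⟩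
        · rintro rfl
          exact inv_ne_zero hx0 (by rw [← hu]; ring)
        · rw [hu, inv_mul_cancel₀ hx0, one_pow]
        · simp [hy0, hp0]
      obtain ⟨u, hu⟩ := IsAlgClosed.exists_pow_nat_eq (x / y) (n := 2) (by norm_num)
      have hy2 : (y ^ 2) ^ p = y ^ 2 := by
        have e : y ^ 2 = x ^ 3 - 1728 := by linear_combination -hxy
        have e' := map_ofNat (frobenius K p) 1728
        rw [frobenius_def] at e'
        rw [e, sub_pow_char, hj, e']
      have e4 : u ^ 4 * x = x ^ 3 / y ^ 2 := by
        rw [show u ^ 4 = (u ^ 2) ^ 2 by ring, hu]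
        field_simp
      have e6 : u ^ 6 * y = x ^ 3 / y ^ 2 := by
        rw [show u ^ 6 = (u ^ 2) ^ 3 by ring, hu]
        field_simp
      refine ⟨u, ?_, ?_, ?_⟩
      · rintro rfl
        exact div_ne_zero hx0 hy0 (by rw [← hu]; ring)
      · rw [e4, div_pow, hj, hy2]
      · rw [e6, div_pow, hj, hy2]
    · rw [pow_mul', hap] at hx hy
      have hh0 : h ≠ 0 := by
        rintro rfl
        rcases hxy0 with h0 | h0
        · simp [h0, ha] at hx
        · simp [h0, ha] at hy
      obtain ⟨u, hu⟩ := IsAlgClosed.exists_pow_nat_eq ((a : K) / h) (n := p - 1) (by omega)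
      have hu' : u ^ (p - 1) * h = a := by rw [hu, div_mul_cancel₀ _ hh0]
      have hup : u ^ p * h = u * a := by
        rw [← hu']
        conv_lhs => rw [← hpp]
        ring
      have hk : ∀ (k : ℕ) (z : K), z * ((a : K) ^ k * z ^ p - z * h ^ k) = 0 →
          (u ^ k * z) ^ p = u ^ k * z := by
        intro k z hz
        rcases mul_eq_zero.1 hz with rfl | hz
        · simp [hp0]
        apply mul_right_cancel₀ (pow_ne_zero k hh0)
        calc _ = (u ^ p * h) ^ k * z ^ p := by ring
          _ = _ := by
            rw [hup]
            linear_combination u ^ k * hz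
      refine ⟨u, ?_, hk 4 x hx, hk 6 y hy, hu'⟩
      rintro rfl
      rw [zero_pow hp1] at hu
      exact div_ne_zero ha hh0 hu.symm
  obtain ⟨u, hu, hux, huy, hua⟩ := hkey
  let ι := ZMod.castHom (dvd_refl p) K
  have hι : ∀ z : K, z ^ p = z → ∃ n, ι n = z := by
    intro z hz
    obtain ⟨n, hn⟩ := (ZMod.fieldRange_castHom_eq_bot (K := K) p).ge
      ((Subfield.mem_bot_iff_pow_eq_self K p).2 hz)
    exact ⟨n, hn⟩
  obtain ⟨α', hα'⟩ := hι _ hux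
  obtain ⟨β', hβ'⟩ := hι _ huy
  obtain ⟨d, hd⟩ := hι c (by
    have e := congrArg (frobenius K p) hc
    rw [map_mul, map_ofNat, map_one, frobenius_def] at e
    exact mul_right_cancel₀ h1728 (e.trans hc.symm))
  refine ⟨-36 * d * α', 2 * d * β', fun h0 => ?_, ι.injective ?_⟩
  · have e := congrArg ι h0
    simp only [map_add, map_mul, map_pow, map_neg, map_ofNat, map_zero, hα', hβ', hd] at e
    have e2 : c ^ 3 * 1728 * u ^ 12 * (4 * 27 * 1728) = 0 := by
      linear_combination -e - (4 * 27 * c ^ 3 * 1728 * u ^ 12) * hxy -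
        108 * c ^ 2 * u ^ 12 * y ^ 2 * hc
    have h108 : (4 * 27 * 1728 : K) ≠ 0 := by
      refine mul_ne_zero (fun h => h1728 ?_) h1728
      linear_combination 16 * h
    exact mul_ne_zero (mul_ne_zero (mul_ne_zero (pow_ne_zero _ hc0) h1728) (pow_ne_zero _ hu)) h108 e2
  · rw [hasseInvariant_map]
    simp only [map_mul, map_neg, map_ofNat, map_intCast, hα', hβ', hd]
    rw [← hua, ← hh, ← hasseInvariant_mul_pow hodd hu]
    congr 1 <;> ring

section

open UpperHalfPlane ModularForm
open scoped MatrixGroups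

/-- A place of `ℂ` above a prime factor `z` of `p = z * conj z`. -/
theorem exists_valuationSubring_inv_notMem {p : ℕ} (hp : p.Prime) {z : ℂ}
    (hz : z * starRingEnd ℂ z = p) :
    ∃ V : ValuationSubring ℂ, (∀ x, IsIntegral ℤ x → x ∈ V) ∧ z⁻¹ ∉ V := by
  have hnot : z⁻¹ ∉ (integralClosure ℤ ℂ).toSubring := by
    intro (h : IsIntegral ℤ z⁻¹)
    have h2 : IsIntegral ℤ (starRingEnd ℂ z⁻¹) := map_isIntegral_int _ h
    have h3 : z⁻¹ * starRingEnd ℂ z⁻¹ = algebraMap ℚ ℂ ((p : ℚ)⁻¹) := by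
      rw [map_inv₀, ← mul_inv, hz]
      simp
    have h4 := h.mul h2
    rw [h3, isIntegral_algebraMap_iff (algebraMap ℚ ℂ).injective,
      IsIntegrallyClosed.isIntegral_iff] at h4
    obtain ⟨n, hn⟩ := h4
    have hp0 : (p : ℚ) ≠ 0 := by exact_mod_cast hp.ne_zero
    have h5 : (n : ℚ) * p = 1 := by
      rw [← eq_intCast (algebraMap ℤ ℚ), hn, inv_mul_cancel₀ hp0]
    have h6 : n * (p : ℤ) = 1 := by exact_mod_cast h5
    exact hp.one_lt.ne' (by exact_mod_cast Int.eq_one_of_mul_eq_one_left (by positivity) h6)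
  have : IsIntegrallyClosedIn (integralClosure ℤ ℂ).toSubring ℂ :=
    inferInstanceAs (IsIntegrallyClosedIn (integralClosure ℤ ℂ) ℂ)
  obtain ⟨V, hV, hzV⟩ := Subring.exists_le_valuationSubring_of_isIntegrallyClosedIn hnot
  exact ⟨V, fun x hx => hV hx, hzV⟩

theorem exists_upperHalfPlane_mul_conj {p : ℕ} {a : ℤ} (ha : a ^ 2 < 4 * p) :
    ∃ τ : ℍ, (τ : ℂ) * starRingEnd ℂ τ = p ∧ (τ : ℂ) + starRingEnd ℂ τ = a := by
  have h : (0 : ℝ) < 4 * p - a ^ 2 := by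
    rw [sub_pos]
    exact_mod_cast ha
  refine ⟨⟨⟨a / 2, √(4 * p - a ^ 2) / 2⟩, by simpa using Real.sqrt_pos.2 h⟩, ?_, ?_⟩
  · apply Complex.ext
    · simp
      nlinarith [Real.mul_self_sqrt h.le]
    · simp
      ring
  · apply Complex.ext <;> simp

theorem ModularForm.apply_isogDown_zero {p : ℕ} [hp : Fact p.Prime] {a : ℤ} {τ : ℍ}
    (hτ : (τ : ℂ) * starRingEnd ℂ τ = p) (hτ' : (τ : ℂ) + starRingEnd ℂ τ = a) {k : ℕ}
    (hk : Even k) (f : ModularForm 𝒮ℒ k) :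
    f (isogDown p 0 τ) = starRingEnd ℂ τ ^ k * f τ := by
  have hp0 : (p : ℂ) ≠ 0 := by exact_mod_cast hp.out.ne_zero
  rw [f.apply_eq_of_coe_eq ⟨!![0, -1; 1, -a], by simp [Matrix.det_fin_two]⟩ (w := τ)]
  · simp only [Matrix.of_apply, Matrix.cons_val_one, Matrix.cons_val_zero, Matrix.cons_val',
      Int.cast_one, Int.cast_neg, one_mul]
    rw [← hk.neg_pow]
    congr 2
    linear_combination -hτ'
  · simp only [Matrix.of_apply, Matrix.cons_val_one, Matrix.cons_val_zero, Matrix.cons_val',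
      Int.cast_one, Int.cast_neg, Int.cast_zero, one_mul, coe_isogDown]
    field_simp
    linear_combination (τ : ℂ) * hτ' - hτ

theorem ValuationSubring.mem_of_sq_mem {K : Type*} [Field K] (V : ValuationSubring K) {x : K}
    (h : x ^ 2 ∈ V) : x ∈ V := by
  rcases V.mem_or_inv_mem x with hx | hx
  · exact hx
  · rcases eq_or_ne x 0 with rfl | h0
    · exact V.zero_mem
    · have := V.mul_mem _ _ h hx
      rwa [pow_two, mul_assoc, mul_inv_cancel₀ h0, mul_one] at this

end

section

open UpperHalfPlane ModularForm
open scoped MatrixGroups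

theorem exists_hasseInvariant_eq {p : ℕ} [hp : Fact p.Prime] (h5 : 5 ≤ p) {a : ℤ}
    (ha : a ^ 2 < 4 * p) :
    ∃ α β : ZMod p, 4 * α ^ 3 + 27 * β ^ 2 ≠ 0 ∧ hasseInvariant p α β = a := by
  obtain ⟨τ, hτ, hτ'⟩ := exists_upperHalfPlane_mul_conj ha
  obtain ⟨V, hV, hVτ⟩ := exists_valuationSubring_inv_notMem hp.out hτ
  have hτ0 : (τ : ℂ) ≠ 0 := ne_zero τ
  have hτint : IsIntegral ℤ (τ : ℂ) := by
    refine ⟨Polynomial.X ^ 2 - Polynomial.C a * Polynomial.X + Polynomial.C (p : ℤ), by monicity!, ?_⟩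
    simp only [Polynomial.eval₂_add, Polynomial.eval₂_sub, Polynomial.eval₂_mul,
      Polynomial.eval₂_pow, Polynomial.eval₂_X, Polynomial.eval₂_C]
    simp only [algebraMap_int_eq, eq_intCast, Int.cast_natCast]
    linear_combination (τ : ℂ) * hτ' - hτ
  have hV' : ∀ (x : V) (y : ℂ), (x : ℂ) * y = 1 → y ∉ V → ¬ IsUnit x := fun x y hxy hy hx => by
    obtain ⟨⟨x, z, hxz, hzx⟩, rfl⟩ := hx
    apply hy
    have h1 : (x : ℂ) * z = 1 := congrArg Subtype.val hxz
    have h2 : y = z := by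
      calc y = (x * z) * y := by rw [h1, one_mul]
        _ = (x * y) * z := by ring
        _ = z := by rw [hxy, one_mul]
    rw [h2]
    exact z.2
  let K := AlgebraicClosure (IsLocalRing.ResidueField V)
  let φ : V →+* K := (algebraMap (IsLocalRing.ResidueField V) K).comp (IsLocalRing.residue V)
  have hφ : ∀ x : V, φ x = 0 ↔ ¬ IsUnit x := fun x => by
    rw [← IsLocalRing.residue_ne_zero_iff_isUnit, not_not]
    exact map_eq_zero_iff _ (algebraMap (IsLocalRing.ResidueField V) K).injective
  let π : V := ⟨τ, hV _ hτint⟩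
  let π' : V := ⟨starRingEnd ℂ τ, hV _ (map_isIntegral_int _ hτint)⟩
  have hπ : π * π' = p := Subtype.ext (by simpa using hτ)
  have hππ' : π + π' = a := Subtype.ext (by simpa using hτ')
  have hφπ : φ π = 0 := (hφ π).2 (hV' π _ (mul_inv_cancel₀ hτ0) hVτ)
  have hφπ' : φ π' = a := by
    have := congrArg φ hππ'
    rwa [map_add, hφπ, zero_add, map_intCast] at this
  have hchar : CharP K p := by
    have h0 : (p : K) = 0 := by
      rw [← map_natCast φ, ← hπ, map_mul, hφπ, zero_mul]
    exact ringChar.of_eq (CharP.ringChar_of_prime_eq_zero hp.out h0)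
  have hp0 := hp.out.ne_zero
  have hζprim := Complex.isPrimitiveRoot_exp p hp0
  let ζ : V := ⟨Complex.exp (2 * Real.pi * Complex.I / p), hV _ (hζprim.isIntegral hp.out.pos)⟩
  have hφζ : φ ζ = 1 := by
    have h1 : ζ ^ p = 1 := Subtype.ext (by simpa using hζprim.pow_eq_one)
    have h2 := congrArg φ h1
    rw [map_pow, map_one, ← one_pow p] at h2
    exact frobenius_inj K p h2
  have h1728 : IsUnit (1728 : V) := by
    by_contra hcon
    have h := (hφ _).2 hcon
    rw [map_ofNat] at h
    have h' : ((1728 : ℕ) : K) = 0 := by exact_mod_cast h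
    rw [CharP.cast_eq_zero_iff K p, show 1728 = 2 ^ 6 * 3 ^ 3 by norm_num,
      hp.out.dvd_mul] at h'
    rcases h' with h' | h' <;> have := Nat.le_of_dvd (by norm_num) (hp.out.dvd_of_dvd_pow h') <;>
      omega
  obtain ⟨c, hc⟩ : ∃ c : V, c * 1728 = 1 := h1728.exists_left_inv
  have hpt := fun {k : ℕ} (hk : Even k) (f : ModularForm 𝒮ℒ k) => f.apply_isogDown_zero hτ hτ' hk
  have hptE : ∀ {k : ℕ} (hk : Even k) {F f}, IsIntegralForm V k F f →
      F (isogDown p 0 τ) = algebraMap V ℂ π' ^ k * F τ := by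
    rintro k hk F f ⟨⟨g, rfl⟩, -⟩
    exact hpt hk g
  obtain ⟨l, hl⟩ := IsAlgClosed.exists_pow_nat_eq (discriminant τ)⁻¹ (n := 12) (by norm_num)
  have hd := discriminant_ne_zero τ
  have hD : l ^ 12 * discriminant τ = 1 := by rw [hl, inv_mul_cancel₀ hd]
  have hl0 : l ≠ 0 := by rintro rfl; simp at hD
  have hdisc : E₄ τ ^ 3 - E₆ τ ^ 2 = 1728 * discriminant τ := by
    rw [discriminant_eq_E₄_cube_sub_E₆_sq]
    ring
  have hB2 : (l ^ 6 * E₆ τ) ^ 2 = (l ^ 4 * E₄ τ) ^ 3 - 1728 := by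
    linear_combination -l ^ 12 * hdisc - 1728 * hD
  have hcoe : ((1728 : V) : ℂ) = 1728 := map_ofNat V.subtype 1728
  have hΔ := isIntegralForm_discriminant (R := V) hc
  have hE₄ := (isIntegralForm_E₄ (R := V)).congr_weight (K' := (4 : ℕ)) (by norm_num)
  have hE₆ := (isIntegralForm_E₆ (R := V)).congr_weight (K' := (6 : ℕ)) (by norm_num)
  have hmem : l ^ 4 * E₄ τ ∈ V := by
    by_contra hA
    have hA' := (V.mem_or_inv_mem _).resolve_left hA
    have hA0 : l ^ 4 * E₄ τ ≠ 0 := fun h => hA (h ▸ V.zero_mem)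
    obtain ⟨m, hm⟩ := IsAlgClosed.exists_pow_nat_eq (l ^ 4 * E₄ τ)⁻¹ (n := 4) (by norm_num)
    have h4 : (m * l) ^ 4 * E₄ τ = 1 := by
      rw [mul_pow, mul_assoc, hm, inv_mul_cancel₀ hA0]
    have h12 : (m * l) ^ 12 * discriminant τ = (l ^ 4 * E₄ τ)⁻¹ ^ 3 := by
      rw [← hm]
      linear_combination m ^ 12 * hD
    let D₀ : V := ⟨_, hA'⟩
    have hD₀ : φ D₀ = 0 := (hφ _).2 (hV' _ _ (inv_mul_cancel₀ hA0) hA)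
    have h6 : (m * l) ^ 6 * E₆ τ ∈ V := by
      apply V.mem_of_sq_mem
      have : ((m * l) ^ 6 * E₆ τ) ^ 2 = ((1 - 1728 * D₀ ^ 3 : V) : ℂ) := by
        push_cast
        rw [hcoe]
        linear_combination -(m * l) ^ 12 * hdisc - 1728 * h12 +
          (((m * l) ^ 4 * E₄ τ) ^ 2 + (m * l) ^ 4 * E₄ τ + 1) * h4
      rw [this]
      exact Subtype.property _
    refine map_discriminant_ne_zero_of_isogDown (p := p) hc (l := m * l) (τ := τ) (B := ⟨_, h6⟩)
      (D := D₀ ^ 3) (ζ := ζ) (π := π) (π' := π') ?_ h4 rfl ?_ φ rfl hφζ hπ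
      (hptE (k := 12) (by decide) hΔ) (by rw [map_pow, hD₀, zero_pow three_ne_zero])
    · rintro h
      simp [h] at h4
    · rw [h12]
      rfl
  have hmem' : l ^ 6 * E₆ τ ∈ V := by
    apply V.mem_of_sq_mem
    rw [hB2]
    exact sub_mem (pow_mem hmem 3) (hcoe ▸ (1728 : V).2)
  let A : V := ⟨_, hmem⟩
  let B : V := ⟨_, hmem'⟩
  have hAB : A ^ 3 - B ^ 2 = 1728 := Subtype.ext (by
    push_cast
    rw [hcoe]
    linear_combination -hB2)
  have hodd : p % 2 = 1 := hp.out.eq_two_or_odd.resolve_left (by omega)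
  have hx := hE₄.frobenius_relation h5 hc hl0 (A := A) (B := B) (α := A) (π := π) rfl rfl φ
    (ζ := ζ) rfl hφζ hπ hφπ (by norm_num) (by norm_num) (by simp only [map_serQ]) rfl
    (hptE (by decide) hE₄)
  have hy := hE₆.frobenius_relation h5 hc hl0 (A := A) (B := B) (α := B) (π := π) rfl rfl φ
    (ζ := ζ) rfl hφζ hπ hφπ (by norm_num) (by norm_num) (by simp only [map_serR]) rfl
    (hptE (by decide) hE₆)
  have hj := pow_eq_self_of_isogDown hc (A := A) (B := B) rfl rfl hD φ (ζ := ζ) rfl hφζ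
    (hpt (k := 12) (by decide))
  rw [hφπ'] at hx hy
  refine exists_zmod_hasseInvariant_eq hodd a (c := φ c) ?_ ?_ rfl hx hy hj
  · simpa only [map_mul, map_ofNat, map_one] using congrArg φ hc
  · simpa only [map_sub, map_pow, map_ofNat] using congrArg φ hAB

end

/-- **Honda's theorem**: for every prime `p` and every integer `a` with
`|a| ≤ 2√p`, there exists an elliptic curve over `𝔽_p = ZMod p` (given as a
Weierstrass curve with unit discriminant) whose trace of Frobenius equals `a`,
i.e. with exactly `p + 1 - a` rational points. -/
theorem honda_exists_elliptic_curve_of_trace (p : ℕ) (hp : p.Prime) (a : ℤ)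
    (ha : |(a : ℝ)| ≤ 2 * Real.sqrt p) :
    ∃ W : WeierstrassCurve (ZMod p), W.IsElliptic ∧
      (Nat.card W.toAffine.Point : ℤ) = p + 1 - a := by
  have : Fact p.Prime := ⟨hp⟩
  have h : a ^ 2 ≤ 4 * p := by
    have h1 := pow_le_pow_left₀ (abs_nonneg _) ha 2
    rw [sq_abs, mul_pow, Real.sq_sqrt (Nat.cast_nonneg p)] at h1
    norm_num at h1
    exact_mod_cast h1
  rcases lt_or_ge p 41 with h41 | h41
  · exact exists_curve_of_lt hp h41 a h
  have hlt : a ^ 2 < 4 * p := by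
    refine lt_of_le_of_ne h fun he => ?_
    have h2 : (2 : ℤ) ∣ a := Int.prime_two.dvd_of_dvd_pow (n := 2) (by rw [he]; exact ⟨2 * p, by ring⟩)
    obtain ⟨b, rfl⟩ := h2
    have hb : b ^ 2 = p := by linarith
    exact (Nat.prime_iff_prime_int.1 hp).irreducible.not_isSquare ⟨b, by rw [← hb, pow_two]⟩
  obtain ⟨α, β, hΔ, hh⟩ := exists_hasseInvariant_eq (p := p) (by omega) hlt
  exact exists_curve_of_hasseInvariant h41 a h α β hΔ hh
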